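/- Let n ≥ 2, p > 1, let Ω ⊂ ℝⁿ be a strongly convex bounded open set with boundary of class C², and let u be the unique positive first eigenfunction of the Gaussian-weighted p-Laplacian on Ω normalized by ∫_Ω u^p dγ = 1. Then the normalized minimizers of the regularized problems converge to u in W^{1,p}(γ): for every η > 0 there exists ε₀ > 0 such that for every ε ∈ (0, ε₀) and every normalized minimizer u_ε of the ε-regularized problem, ∫_Ω ( ‖∇u_ε − ∇u‖^p + |u_ε − u|^p ) dγ < η. -/

import Mathlib

open MeasureTheory Real Set Metric Bornology
open scoped RealInnerProductSpace Pointwise NNReal Topology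

noncomputable def gaussianMeasure (n : ℕ) : Measure (EuclideanSpace ℝ (Fin n)) :=
  (volume : Measure (EuclideanSpace ℝ (Fin n))).withDensity
    (fun x => ENNReal.ofReal ((2 * π) ^ (-(n : ℝ) / 2) * Real.exp (-‖x‖ ^ 2 / 2)))

/-- `φ` is a smooth compactly supported test function on `Ω`. -/
def IsTestFun (n : ℕ) (Ω : Set (EuclideanSpace ℝ (Fin n)))
    (φ : EuclideanSpace ℝ (Fin n) → ℝ) : Prop :=
  ContDiff ℝ (⊤ : ℕ∞) φ ∧ HasCompactSupport φ ∧ tsupport φ ⊆ Ω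

/-- The first eigenvalue of the Gaussian-weighted `p`-Laplacian on `Ω`. -/
noncomputable def lambdaPGamma (n : ℕ) (p : ℝ) (Ω : Set (EuclideanSpace ℝ (Fin n))) : ℝ :=
  sInf { r : ℝ | ∃ v : EuclideanSpace ℝ (Fin n) → ℝ, IsTestFun n Ω v ∧ v ≠ 0 ∧
    r = (∫ x in Ω, ‖gradient v x‖ ^ p ∂(gaussianMeasure n)) /
        (∫ x in Ω, |v x| ^ p ∂(gaussianMeasure n)) }

/-- `Ω` has boundary of class `C²`. -/
def HasC2Boundary (n : ℕ) (Ω : Set (EuclideanSpace ℝ (Fin n))) : Prop :=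
  ∀ x ∈ frontier Ω, ∃ (U : Set (EuclideanSpace ℝ (Fin n))) (f : EuclideanSpace ℝ (Fin n) → ℝ),
    IsOpen U ∧ x ∈ U ∧ ContDiff ℝ 2 f ∧ (∀ y ∈ U, (y ∈ Ω ↔ f y < 0)) ∧
    (∀ y ∈ U, y ∈ frontier Ω → fderiv ℝ f y ≠ 0)

/-- The regularized functional `J_ε(v) = ∫_Ω (ε v² + ‖∇v‖²)^{p/2} dγ`. -/
noncomputable def Jeps (n : ℕ) (p ε : ℝ) (Ω : Set (EuclideanSpace ℝ (Fin n)))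
    (v : EuclideanSpace ℝ (Fin n) → ℝ) : ℝ :=
  ∫ x in Ω, (ε * v x ^ 2 + ‖gradient v x‖ ^ 2) ^ (p / 2) ∂(gaussianMeasure n)

/-- The infimum of the regularized functional over normalized test functions. -/
noncomputable def lambdaEps (n : ℕ) (p ε : ℝ) (Ω : Set (EuclideanSpace ℝ (Fin n))) : ℝ :=
  sInf { r : ℝ | ∃ v : EuclideanSpace ℝ (Fin n) → ℝ, IsTestFun n Ω v ∧
    (∫ x in Ω, |v x| ^ p ∂(gaussianMeasure n)) = 1 ∧ r = Jeps n p ε Ω v }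

/-- A normalized minimizer of the `ε`-regularized problem. -/
def IsNormalizedMinimizer (n : ℕ) (p ε : ℝ) (Ω : Set (EuclideanSpace ℝ (Fin n)))
    (uε : EuclideanSpace ℝ (Fin n) → ℝ) : Prop :=
  ContinuousOn uε (closure Ω) ∧ ContDiffOn ℝ 1 uε Ω ∧
  (∀ x ∈ closure Ω, 0 ≤ uε x) ∧ (∀ x ∈ frontier Ω, uε x = 0) ∧
  (∫ x in Ω, uε x ^ p ∂(gaussianMeasure n)) = 1 ∧
  Jeps n p ε Ω uε = lambdaEps n p ε Ω

section Bregman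
variable {F : Type*} [NormedAddCommGroup F] [InnerProductSpace ℝ F]

noncomputable def breg (p : ℝ) (ξ ζ : F) : ℝ :=
  ‖ξ‖ ^ p - ‖ζ‖ ^ p - p * (‖ζ‖ ^ (p - 2) * ⟪ζ, ξ - ζ⟫)

lemma rpow_sub_two_mul_sq {z p : ℝ} (hz : 0 < z) : z ^ (p - 2) * z ^ 2 = z ^ p := by
  rw [← Real.rpow_natCast, ← Real.rpow_add hz]; norm_num

lemma breg_pos {p : ℝ} (hp : 1 < p) {ξ ζ : F} (h : ξ ≠ ζ) : 0 < breg p ξ ζ := by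
  unfold breg
  rcases eq_or_ne ζ 0 with rfl | hζ
  · have : 0 < ‖ξ‖ := norm_pos_iff.2 h
    simp only [norm_zero, inner_zero_left, mul_zero, sub_zero]
    rw [Real.zero_rpow (by linarith)]
    have := Real.rpow_pos_of_pos this p
    linarith
  · have hz : 0 < ‖ζ‖ := norm_pos_iff.2 hζ
    have hzp := Real.rpow_pos_of_pos hz p
    have hzp2 := Real.rpow_pos_of_pos hz (p - 2)
    have hmul := rpow_sub_two_mul_sq (p := p) hz
    set z := ‖ζ‖ with hzdef
    rw [inner_sub_right, real_inner_self_eq_norm_sq, ← hzdef]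
    by_cases hr : ‖ξ‖ = z
    · have h1 := norm_sub_sq_real ξ ζ
      have h2 : 0 < ‖ξ - ζ‖ := norm_pos_iff.2 (sub_ne_zero.2 h)
      rw [real_inner_comm, hr, ← hzdef] at h1
      rw [hr]
      have : ⟪ζ, ξ⟫ - z ^ 2 < 0 := by nlinarith
      have := mul_neg_of_pos_of_neg hzp2 this
      nlinarith
    · set r := ‖ξ‖ / z with hrdef
      have hξ : ‖ξ‖ = z * r := by rw [hrdef]; field_simp
      have hr0 : 0 ≤ r := by positivity
      have hr1 : r ≠ 1 := by
        intro h1; rw [h1, mul_one] at hξ; exact hr hξ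
      have hb := one_add_mul_self_lt_rpow_one_add (s := r - 1) (by linarith)
        (sub_ne_zero.2 hr1) hp
      rw [show 1 + (r - 1) = r by ring] at hb
      have hin : ⟪ζ, ξ⟫ ≤ z ^ 2 * r := by
        have := real_inner_le_norm ζ ξ
        rw [hξ] at this; nlinarith
      have h3 : z ^ (p - 2) * (⟪ζ, ξ⟫ - z ^ 2) ≤ z ^ p * (r - 1) := by
        rw [← hmul]
        nlinarith [mul_le_mul_of_nonneg_left hin hzp2.le]
      rw [hξ, Real.mul_rpow hz.le hr0]
      nlinarith [mul_lt_mul_of_pos_left hb hzp]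

lemma breg_nonneg {p : ℝ} (hp : 1 < p) (ξ ζ : F) : 0 ≤ breg p ξ ζ := by
  rcases eq_or_ne ξ ζ with rfl | h
  · simp [breg]
  · exact (breg_pos hp h).le

lemma breg_continuous {p : ℝ} (hp : 1 < p) : Continuous (fun x : F × F => breg p x.1 x.2) := by
  have h1 : ∀ x : F × F, breg p x.1 x.2 = ‖x.1‖ ^ p - ‖x.2‖ ^ p -
      (fderiv ℝ (fun y : F => ‖y‖ ^ p) x.2) (x.1 - x.2) := by
    intro x
    rw [fderiv_norm_rpow _ hp]
    simp [breg]; ring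
  simp_rw [h1]
  have h2 := (contDiff_norm_rpow (E := F) hp).continuous_fderiv one_ne_zero
  have h3 := (contDiff_norm_rpow (E := F) hp).continuous
  exact ((h3.comp continuous_fst).sub (h3.comp continuous_snd)).sub
    ((h2.comp continuous_snd).clm_apply (continuous_fst.sub continuous_snd))

lemma breg_smul {p : ℝ} (t : ℝ) (ht : 0 < t) (ξ ζ : F) :
    breg p (t • ξ) (t • ζ) = t ^ p * breg p ξ ζ := by
  unfold breg
  rw [← smul_sub, real_inner_smul_left, real_inner_smul_right, norm_smul, norm_smul,
    Real.norm_of_nonneg ht.le, Real.mul_rpow ht.le (norm_nonneg _),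
    Real.mul_rpow ht.le (norm_nonneg _), Real.mul_rpow ht.le (norm_nonneg _),
    ← rpow_sub_two_mul_sq ht]
  ring

lemma breg_key [FiniteDimensional ℝ F] {p : ℝ} (hp : 1 < p) {θ : ℝ} (hθ : 0 < θ) :
    ∃ C : ℝ, 0 ≤ C ∧ ∀ ξ ζ : F, ‖ξ - ζ‖ ^ p ≤ θ * (‖ξ‖ ^ p + ‖ζ‖ ^ p) + C * breg p ξ ζ := by
  have hp0 : 0 < p := by linarith
  have hc : Continuous (fun y : F => ‖y‖ ^ p) := (contDiff_norm_rpow (E := F) hp).continuous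
  have hcs : Continuous (fun x : F × F => ‖x.1 - x.2‖ ^ p) :=
    hc.comp (continuous_fst.sub continuous_snd)
  have hcn : Continuous (fun x : F × F => ‖x.1‖ ^ p + ‖x.2‖ ^ p) :=
    (hc.comp continuous_fst).add (hc.comp continuous_snd)
  let S : Set (F × F) := {x | ‖x.1‖ ^ p + ‖x.2‖ ^ p = 1 ∧ θ ≤ ‖x.1 - x.2‖ ^ p}
  have hScl : IsClosed S :=
    (isClosed_eq hcn continuous_const).inter (isClosed_le continuous_const hcs)
  have hle1 : ∀ a : F, ‖a‖ ^ p ≤ 1 → ‖a‖ ≤ 1 := by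
    intro a ha
    by_contra hcon
    push Not at hcon
    exact absurd (Real.one_lt_rpow hcon hp0) (not_lt.2 ha)
  have hSb : S ⊆ closedBall 0 1 := by
    rintro ⟨a, b⟩ ⟨h1, -⟩
    simp only at h1
    have ha := Real.rpow_nonneg (norm_nonneg a) p
    have hb := Real.rpow_nonneg (norm_nonneg b) p
    rw [mem_closedBall_zero_iff, Prod.norm_def]
    exact max_le (hle1 a (by linarith)) (hle1 b (by linarith))
  have hScpt : IsCompact S := (isCompact_closedBall 0 1).of_isClosed_subset hScl hSb
  obtain ⟨m, hm, hmS⟩ : ∃ m : ℝ, 0 < m ∧ ∀ x ∈ S, m ≤ breg p x.1 x.2 := by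
    rcases S.eq_empty_or_nonempty with hS | hS
    · exact ⟨1, one_pos, by simp [hS]⟩
    · obtain ⟨x, hx, hmin⟩ := hScpt.exists_isMinOn hS (breg_continuous hp).continuousOn
      refine ⟨breg p x.1 x.2, breg_pos hp ?_, fun y hy => hmin hy⟩
      intro h
      have := hx.2
      rw [h, sub_self, norm_zero, Real.zero_rpow hp0.ne'] at this
      linarith
  refine ⟨2 ^ p / m, by positivity, ?_⟩
  intro ξ ζ
  have hξ := Real.rpow_nonneg (norm_nonneg ξ) p
  have hζ := Real.rpow_nonneg (norm_nonneg ζ) p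
  have hbn := breg_nonneg hp ξ ζ
  have hCb : 0 ≤ 2 ^ p / m * breg p ξ ζ := by positivity
  rcases (add_nonneg hξ hζ).eq_or_lt with h0 | hpos
  · have h1 : ‖ξ‖ ^ p = 0 := by linarith
    have h2 : ‖ζ‖ ^ p = 0 := by linarith
    rw [Real.rpow_eq_zero (norm_nonneg _) hp0.ne', norm_eq_zero] at h1 h2
    subst h1; subst h2
    simp only [sub_self, norm_zero, Real.zero_rpow hp0.ne'] at hCb ⊢
    simpa using hCb
  · set s := ‖ξ‖ ^ p + ‖ζ‖ ^ p with hs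
    set t := s ^ (-(1 / p)) with ht
    have htpos : 0 < t := Real.rpow_pos_of_pos hpos _
    have htp : t ^ p = s⁻¹ := by
      rw [ht, ← Real.rpow_mul hpos.le, show -(1 / p) * p = -1 by field_simp, Real.rpow_neg_one]
    have hn : ∀ a : F, ‖t • a‖ ^ p = s⁻¹ * ‖a‖ ^ p := by
      intro a
      rw [norm_smul, Real.norm_of_nonneg htpos.le, Real.mul_rpow htpos.le (norm_nonneg _), htp]
    by_cases hsm : ‖ξ - ζ‖ ^ p ≤ θ * s
    · linarith
    · push Not at hsm
      have hmem : (t • ξ, t • ζ) ∈ S := by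
        refine ⟨?_, ?_⟩
        · simp only [hn]; rw [← mul_add, ← hs]; exact inv_mul_cancel₀ hpos.ne'
        · simp only [← smul_sub, hn]
          rw [inv_mul_eq_div, le_div_iff₀ hpos]; exact hsm.le
      have h1 := hmS _ hmem
      simp only [breg_smul t htpos, htp] at h1
      have h2 : m * s ≤ breg p ξ ζ := by
        rw [inv_mul_eq_div, le_div_iff₀ hpos] at h1; exact h1
      have h3 : ‖ξ - ζ‖ ^ p ≤ 2 ^ p * s := by
        have hx1 : ‖t • ξ‖ ≤ 1 := hle1 _ (by rw [hn, inv_mul_eq_div, div_le_one hpos]; linarith)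
        have hx2 : ‖t • ζ‖ ≤ 1 := hle1 _ (by rw [hn, inv_mul_eq_div, div_le_one hpos]; linarith)
        have h4 : ‖t • (ξ - ζ)‖ ≤ 2 := by
          rw [smul_sub]; linarith [norm_sub_le (t • ξ) (t • ζ)]
        have h5 := Real.rpow_le_rpow (norm_nonneg _) h4 hp0.le
        rw [hn, inv_mul_eq_div, div_le_iff₀ hpos] at h5
        exact h5
      have h6 : 2 ^ p * s ≤ 2 ^ p / m * breg p ξ ζ := by
        rw [div_mul_eq_mul_div, le_div_iff₀ hm]
        have : (0:ℝ) < 2 ^ p := by positivity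
        nlinarith
      nlinarith
end Bregman

section Poin
variable {n : ℕ}
local notation "𝔼" => EuclideanSpace ℝ (Fin n)

lemma measurable_gradient (f : 𝔼 → ℝ) : Measurable (gradient f) := by
  unfold gradient
  exact (LinearIsometryEquiv.continuous _).measurable.comp (measurable_fderiv ℝ f)

lemma lintegral_jensen {p : ℝ} (hp : 1 < p) (g : ℝ → ENNReal) (hg : Measurable g) :
    (∫⁻ t in Icc (0:ℝ) 1, g t) ^ p ≤ ∫⁻ t in Icc (0:ℝ) 1, g t ^ p := by
  have h := ENNReal.lintegral_mul_le_Lp_mul_Lq (volume.restrict (Icc (0:ℝ) 1))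
    (Real.HolderConjugate.conjExponent hp) hg.aemeasurable (g := fun _ => 1) aemeasurable_const
  simp only [Pi.mul_apply, mul_one, ENNReal.one_rpow, lintegral_const, Measure.restrict_apply_univ,
    Real.volume_Icc, sub_zero, ENNReal.ofReal_one] at h
  calc _ ≤ _ := ENNReal.rpow_le_rpow h (by linarith)
    _ = _ := by
      rw [← ENNReal.rpow_mul, one_div_mul_cancel (by linarith), ENNReal.rpow_one]

lemma lintegral_affine_le (G : 𝔼 → ENNReal) (hG : Measurable G) (c : ℝ) (hc : 1 ≤ c) (h : 𝔼) :
    ∫⁻ x, G (c • x + h) ≤ ∫⁻ x, G x := by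
  have h1 : ∫⁻ x, G (c • x + h) = ∫⁻ y, G (y + h) ∂(Measure.map (c • ·) volume) := by
    exact (lintegral_map (f := fun y => G (y + h)) (hG.comp (measurable_add_const h))
      (measurable_const_smul c)).symm
  rw [h1, Measure.map_addHaar_smul _ (by positivity), lintegral_smul_measure,
    lintegral_add_right_eq_self]
  have : ENNReal.ofReal |(c ^ Module.finrank ℝ 𝔼)⁻¹| ≤ 1 := by
    rw [ENNReal.ofReal_le_one, abs_of_nonneg (by positivity)]
    exact inv_le_one_of_one_le₀ (one_le_pow₀ hc)
  calc _ ≤ 1 * ∫⁻ x, G x := by simp only [smul_eq_mul]; gcongr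
    _ = _ := one_mul _

lemma trans_pointwise {p : ℝ} (hp : 1 < p) (f : 𝔼 → ℝ) (U : Set 𝔼) (hU : IsOpen U)
    (hf : ContDiffOn ℝ 1 f U) (B : Set 𝔼) (hB : MeasurableSet B) (hBU : B ⊆ U) (x d : 𝔼) (M : ℝ)
    (hxd : ∀ t ∈ Icc (0:ℝ) 1, x + t • d ∈ B) (hM : ‖d‖ ≤ M) :
    ‖f (x + d) - f x‖ₑ ^ p ≤ ENNReal.ofReal M ^ p *
      ∫⁻ t in Icc (0:ℝ) 1, B.indicator (fun y => ‖gradient f y‖ₑ ^ p) (x + t • d) := by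
  have hp0 : 0 < p := by linarith
  have hline : ContDiff ℝ 1 (fun t : ℝ => x + t • d) := by fun_prop
  have hg : ContDiffOn ℝ 1 (fun t : ℝ => f (x + t • d)) (Icc 0 1) :=
    hf.comp hline.contDiffOn (fun t ht => hBU (hxd t ht))
  have h1 := enorm_sub_le_lintegral_deriv_of_contDiffOn_Icc hg zero_le_one
  simp only [one_smul, zero_smul, add_zero] at h1
  have hder : ∀ t ∈ Icc (0:ℝ) 1, ‖deriv (fun t : ℝ => f (x + t • d)) t‖ₑ ≤
      ENNReal.ofReal M * B.indicator (fun y => ‖gradient f y‖ₑ) (x + t • d) := by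
    intro t ht
    have hd : DifferentiableAt ℝ f (x + t • d) :=
      (hf.differentiableOn one_ne_zero).differentiableAt (hU.mem_nhds (hBU (hxd t ht)))
    have hl : HasDerivAt (fun t : ℝ => x + t • d) d t := by
      simpa using ((hasDerivAt_id t).smul_const d).const_add x
    have := hd.hasFDerivAt.comp_hasDerivAt t hl
    have h2 : deriv (fun t : ℝ => f (x + t • d)) t = ⟪gradient f (x + t • d), d⟫ := by
      rw [show (fun t : ℝ => f (x + t • d)) = f ∘ (fun t : ℝ => x + t • d) from rfl, this.deriv,
        ← toDual_gradient]
      simp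
    rw [h2, indicator_of_mem (hxd t ht), ← ofReal_norm, ← ofReal_norm,
      ← ENNReal.ofReal_mul ((norm_nonneg _).trans hM)]
    apply ENNReal.ofReal_le_ofReal
    calc _ ≤ _ := norm_inner_le_norm _ _
      _ ≤ _ := by rw [mul_comm]; gcongr
  have hmeas : Measurable (fun t : ℝ => B.indicator (fun y => ‖gradient f y‖ₑ) (x + t • d)) :=
    (((measurable_gradient f).enorm).indicator hB).comp hline.continuous.measurable
  have h3 : ‖f (x + d) - f x‖ₑ ≤ ENNReal.ofReal M *
      ∫⁻ t in Icc (0:ℝ) 1, B.indicator (fun y => ‖gradient f y‖ₑ) (x + t • d) := by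
    refine h1.trans ?_
    rw [← lintegral_const_mul _ hmeas]
    exact setLIntegral_mono (hmeas.const_mul _) hder
  calc _ ≤ _ := ENNReal.rpow_le_rpow h3 hp0.le
    _ = ENNReal.ofReal M ^ p *
      (∫⁻ t in Icc (0:ℝ) 1, B.indicator (fun y => ‖gradient f y‖ₑ) (x + t • d)) ^ p :=
        ENNReal.mul_rpow_of_nonneg _ _ hp0.le
    _ ≤ ENNReal.ofReal M ^ p *
      ∫⁻ t in Icc (0:ℝ) 1, (B.indicator (fun y => ‖gradient f y‖ₑ) (x + t • d)) ^ p := by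
        gcongr; exact lintegral_jensen hp _ hmeas
    _ = _ := by
      congr 2
      ext t
      by_cases h : x + t • d ∈ B <;> simp [h, hp0]

lemma trans_est {p : ℝ} (hp : 1 < p) (f : 𝔼 → ℝ) (U : Set 𝔼) (hU : IsOpen U)
    (hf : ContDiffOn ℝ 1 f U) (B : Set 𝔼) (hB : MeasurableSet B) (hBU : B ⊆ U)
    (A : Set 𝔼) (hA : MeasurableSet A) (a : ℝ) (ha : 0 ≤ a) (h : 𝔼) (M : ℝ)
    (hAB : ∀ x ∈ A, ∀ t ∈ Icc (0:ℝ) 1, x + t • (a • x + h) ∈ B)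
    (hM : ∀ x ∈ A, ‖a • x + h‖ ≤ M) :
    ∫⁻ x in A, ‖f (x + (a • x + h)) - f x‖ₑ ^ p ≤
      ENNReal.ofReal M ^ p * ∫⁻ x in B, ‖gradient f x‖ₑ ^ p := by
  set G : 𝔼 → ENNReal := B.indicator (fun y => ‖gradient f y‖ₑ ^ p) with hGdef
  have hG : Measurable G := (((measurable_gradient f).enorm).pow_const p).indicator hB
  have hc : Continuous (fun z : 𝔼 × ℝ => z.1 + z.2 • (a • z.1 + h)) := by fun_prop
  have hG2 : Measurable (fun z : 𝔼 × ℝ => G (z.1 + z.2 • (a • z.1 + h))) := hG.comp hc.measurable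
  have hin : Measurable (fun x : 𝔼 => ∫⁻ t in Icc (0:ℝ) 1, G (x + t • (a • x + h))) :=
    hG2.lintegral_prod_right'
  calc ∫⁻ x in A, ‖f (x + (a • x + h)) - f x‖ₑ ^ p
      ≤ ∫⁻ x in A, ENNReal.ofReal M ^ p * ∫⁻ t in Icc (0:ℝ) 1, G (x + t • (a • x + h)) :=
        setLIntegral_mono (hin.const_mul _) (fun x hx =>
          trans_pointwise hp f U hU hf B hB hBU x _ M (hAB x hx) (hM x hx))
    _ = ENNReal.ofReal M ^ p * ∫⁻ x in A, ∫⁻ t in Icc (0:ℝ) 1, G (x + t • (a • x + h)) :=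
        lintegral_const_mul _ hin
    _ ≤ ENNReal.ofReal M ^ p * ∫⁻ x, ∫⁻ t in Icc (0:ℝ) 1, G (x + t • (a • x + h)) := by
        gcongr; exact Measure.restrict_le_self
    _ = ENNReal.ofReal M ^ p * ∫⁻ t in Icc (0:ℝ) 1, ∫⁻ x, G (x + t • (a • x + h)) := by
        congr 1
        exact lintegral_lintegral_swap hG2.aemeasurable
    _ ≤ ENNReal.ofReal M ^ p * ∫⁻ t in Icc (0:ℝ) 1, ∫⁻ x, G x := by
        gcongr 1
        refine setLIntegral_mono measurable_const fun t ht => ?_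
        have : ∀ x : 𝔼, x + t • (a • x + h) = (1 + t * a) • x + t • h := by
          intro x; module
        simp_rw [this]
        exact lintegral_affine_le G hG _ (by nlinarith [mul_nonneg ht.1 ha]) _
    _ = _ := by
        simp [hGdef, lintegral_indicator hB]

lemma poincare {p : ℝ} (hp : 1 < p) (f : 𝔼 → ℝ) (U : Set 𝔼) (hU : IsOpen U)
    (hf : ContDiffOn ℝ 1 f U) (K : Set 𝔼) (hK : MeasurableSet K) (hKU : K ⊆ U)
    (hKc : Convex ℝ K) (M : ℝ) (hM : ∀ x ∈ K, ∀ y ∈ K, ‖y - x‖ ≤ M) :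
    ∫⁻ x in K, ∫⁻ y in K, ‖f y - f x‖ₑ ^ p ≤
      (ENNReal.ofReal M ^ p * volume (closedBall (0:𝔼) M)) * ∫⁻ x in K, ‖gradient f x‖ₑ ^ p := by
  classical
  have hp0 : 0 < p := by linarith
  -- measurable replacement of f
  set g : 𝔼 → ℝ := K.indicator f with hg
  have hgm : Measurable g := by
    have : ContinuousOn f K := hf.continuousOn.mono hKU
    rw [hg, ← Set.piecewise_eq_indicator]
    exact this.measurable_piecewise continuousOn_const hK
  set Φ : 𝔼 × 𝔼 → ENNReal := (K ×ˢ K).indicator (fun z => ‖g z.2 - g z.1‖ₑ ^ p) with hΦ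
  have hΦm : Measurable Φ := by
    refine Measurable.indicator ?_ (hK.prod hK)
    exact (((hgm.comp measurable_snd).sub (hgm.comp measurable_fst)).enorm).pow_const p
  have e1 : ∫⁻ x in K, ∫⁻ y in K, ‖f y - f x‖ₑ ^ p = ∫⁻ x, ∫⁻ y, Φ (x, y) := by
    rw [← lintegral_indicator hK]
    congr 1; ext x
    by_cases hx : x ∈ K
    · rw [indicator_of_mem hx, ← lintegral_indicator hK]
      congr 1; ext y
      by_cases hy : y ∈ K <;> simp [hΦ, hx, hy, hg]
    · simp [hx, hΦ]
  have e2 : ∫⁻ x, ∫⁻ y, Φ (x, y) = ∫⁻ x, ∫⁻ h, Φ (x, x + h) := by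
    congr 1; ext x
    exact (lintegral_add_left_eq_self (fun y => Φ (x, y)) x).symm
  have hΦ2 : Measurable (fun z : 𝔼 × 𝔼 => Φ (z.1, z.1 + z.2)) :=
    hΦm.comp (measurable_fst.prodMk (measurable_fst.add measurable_snd))
  have e3 : ∫⁻ x, ∫⁻ h, Φ (x, x + h) = ∫⁻ h, ∫⁻ x, Φ (x, x + h) :=
    lintegral_lintegral_swap hΦ2.aemeasurable
  rw [e1, e2, e3]
  have key : ∀ h : 𝔼, ∫⁻ x, Φ (x, x + h) ≤ (closedBall (0:𝔼) M).indicator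
      (fun _ => ENNReal.ofReal M ^ p * ∫⁻ x in K, ‖gradient f x‖ₑ ^ p) h := by
    intro h
    set A : Set 𝔼 := {x | x ∈ K ∧ x + h ∈ K} with hAdef
    have hA : MeasurableSet A := hK.inter (measurable_add_const h hK)
    have e4 : ∫⁻ x, Φ (x, x + h) = ∫⁻ x in A, ‖f (x + h) - f x‖ₑ ^ p := by
      rw [← lintegral_indicator hA]
      congr 1; ext x
      by_cases hx : x ∈ K <;> by_cases hy : x + h ∈ K <;> simp [hΦ, hAdef, hx, hy, hg]
    rw [e4]
    by_cases hh : h ∈ closedBall (0:𝔼) M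
    · rw [indicator_of_mem hh]
      have := trans_est hp f U hU hf K hK hKU A hA 0 le_rfl h M (fun x hx t ht => by
          have := hKc.add_smul_sub_mem hx.1 hx.2 ht
          simpa using this) (fun x hx => by simpa using hh)
      simpa using this
    · rw [indicator_of_notMem hh]
      have : A = ∅ := by
        ext x
        simp only [mem_empty_iff_false, iff_false]
        rintro ⟨h1, h2⟩
        apply hh
        have := hM x h1 _ h2
        simpa using this
      simp [this]
  calc _ ≤ _ := lintegral_mono key
    _ = _ := by
      rw [lintegral_indicator measurableSet_closedBall]
      simp; ring

lemma strip {p : ℝ} (hp : 1 < p) (Ω : Set 𝔼) (hΩo : IsOpen Ω) (hΩc : Convex ℝ Ω)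
    (hΩb : IsBounded Ω) (hne : Ω.Nonempty) (s : ENNReal) (hs : 0 < s) :
    ∃ K : Set 𝔼, IsCompact K ∧ K ⊆ Ω ∧ Convex ℝ K ∧ (interior K).Nonempty ∧
      ∀ v : 𝔼 → ℝ, ContDiff ℝ 1 v → tsupport v ⊆ Ω →
        ∫⁻ x in Ω \ K, ‖v x‖ₑ ^ p ≤ s * ∫⁻ x in Ω, ‖gradient v x‖ₑ ^ p := by
  have hp0 : 0 < p := by linarith
  obtain ⟨x0, hx0⟩ := hne
  obtain ⟨R, hR⟩ := hΩb.subset_closedBall x0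
  have hcont : Filter.Tendsto (fun a : ℝ => ENNReal.ofReal (a * R) ^ p) (𝓝[>] 0) (𝓝 0) := by
    have : Continuous (fun a : ℝ => ENNReal.ofReal (a * R) ^ p) := by
      exact (ENNReal.continuous_rpow_const).comp
        (ENNReal.continuous_ofReal.comp (by fun_prop))
    have h := (this.tendsto 0).mono_left (nhdsWithin_le_nhds (s := Ioi 0))
    simpa [hp0] using h
  obtain ⟨a, ha, ha0⟩ := ((hcont.eventually_lt_const hs).and self_mem_nhdsWithin).exists
  replace ha0 : 0 < a := ha0
  have h1a : (0:ℝ) < 1 + a := by linarith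
  set c : ℝ := (1 + a)⁻¹ with hc
  have hc0 : 0 < c := by positivity
  set T : 𝔼 → 𝔼 := fun x => x0 + c • (x - x0) with hT
  have hTc : Continuous T := by fun_prop
  set K := T '' closure Ω with hK
  have hKcpt : IsCompact K := (hΩb.isCompact_closure).image hTc
  have hKΩ : K ⊆ Ω := by
    rintro _ ⟨y, hy, rfl⟩
    have := hΩc.closure_subset_image_homothety_interior_of_one_lt
      (x := x0) (by rwa [hΩo.interior_eq]) (1 + a) (by linarith) hy
    rw [hΩo.interior_eq] at this
    obtain ⟨z, hz, rfl⟩ := this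
    have : T (AffineMap.homothety x0 (1 + a) z) = z := by
      simp only [hT, AffineMap.homothety_apply, vsub_eq_sub, vadd_eq_add, add_sub_cancel_right,
        smul_smul, hc, inv_mul_cancel₀ h1a.ne', one_smul]
      abel
    rwa [this]
  have hKconv : Convex ℝ K := by
    have : T = fun x => AffineMap.homothety x0 c x := by
      ext x; simp [hT, AffineMap.homothety_apply, add_comm]
    rw [hK, this]
    exact hΩc.closure.affine_image _
  have hTinv : ∀ x, T (x + a • (x - x0)) = x := by
    intro x
    have : x + a • (x - x0) - x0 = (1 + a) • (x - x0) := by module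
    simp only [hT, this, smul_smul, hc, inv_mul_cancel₀ h1a.ne', one_smul]
    abel
  refine ⟨K, hKcpt, hKΩ, hKconv, ?_, ?_⟩
  · have hsub : (fun x => x + a • (x - x0)) ⁻¹' Ω ⊆ K := fun x hx =>
      ⟨x + a • (x - x0), subset_closure hx, hTinv x⟩
    have hop : IsOpen ((fun x => x + a • (x - x0)) ⁻¹' Ω) := hΩo.preimage (by fun_prop)
    exact ⟨x0, interior_maximal hsub hop (by simpa using hx0)⟩
  · intro v hv hvs
    have hmeas : MeasurableSet (Ω \ K) := hΩo.measurableSet.diff hKcpt.measurableSet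
    have h1 := trans_est hp v univ isOpen_univ hv.contDiffOn univ MeasurableSet.univ
      (subset_univ _) (Ω \ K) hmeas a ha0.le (-(a • x0)) (a * R) (fun _ _ _ _ => mem_univ _)
      (fun x hx => by
        have : a • x + -(a • x0) = a • (x - x0) := by module
        rw [this, norm_smul, Real.norm_of_nonneg ha0.le]
        have := hR hx.1
        rw [mem_closedBall, dist_eq_norm] at this
        gcongr)
    have h2 : ∫⁻ x in Ω \ K, ‖v x‖ₑ ^ p =
        ∫⁻ x in Ω \ K, ‖v (x + (a • x + -(a • x0))) - v x‖ₑ ^ p := by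
      refine setLIntegral_congr_fun hmeas fun x hx => ?_
      have : v (x + (a • x + -(a • x0))) = 0 := by
        have e : x + (a • x + -(a • x0)) = x + a • (x - x0) := by module
        rw [e]
        by_contra hne
        have := hvs (subset_tsupport _ hne)
        exact hx.2 ⟨_, subset_closure this, hTinv x⟩
      simp only [this, zero_sub, enorm_neg]
    have h3 : ∫⁻ x in univ, ‖gradient v x‖ₑ ^ p = ∫⁻ x in Ω, ‖gradient v x‖ₑ ^ p := by
      rw [Measure.restrict_univ, ← lintegral_indicator hΩo.measurableSet]
      congr 1; ext x
      by_cases hx : x ∈ Ω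
      · simp [hx]
      · have : fderiv ℝ v x = 0 := by
          have h := fun h => hx (hvs (tsupport_fderiv_subset ℝ h))
          exact image_eq_zero_of_notMem_tsupport h
        simp [hx, gradient, this, hp0]
    rw [h2]
    refine h1.trans ?_
    rw [h3]
    gcongr
end Poin

section Approx
variable {n : ℕ}
local notation "𝔼" => EuclideanSpace ℝ (Fin n)

open ContinuousLinearMap MeasureTheory in
lemma mollify_aux {F' : Type*} [NormedAddCommGroup F'] [NormedSpace ℝ F'] [CompleteSpace F']
    (g : 𝔼 → F') (hg : Continuous g) (hgc : HasCompactSupport g)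
    (b : ℕ → ContDiffBump (0 : 𝔼))
    (hb : Filter.Tendsto (fun k => (b k).rOut) Filter.atTop (𝓝 0)) :
    (∃ C : ℝ, ∀ k x, ‖(convolution ((b k).normed volume) g (lsmul ℝ ℝ) volume) x‖ ≤ C) ∧
    ∀ x, Filter.Tendsto (fun k => (convolution ((b k).normed volume) g (lsmul ℝ ℝ) volume) x)
      Filter.atTop (𝓝 (g x)) := by
  refine ⟨?_, fun x => ContDiffBump.convolution_tendsto_right_of_continuous hb hg x⟩
  obtain ⟨C, hC⟩ := hg.bounded_above_of_compact_support hgc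
  refine ⟨3 * C, fun k x => ?_⟩
  have h := (b k).dist_normed_convolution_le (μ := volume) (x₀ := x) (ε := 2 * C)
    hg.aestronglyMeasurable (fun y _ => by
      rw [dist_eq_norm]; linarith [norm_sub_le (g y) (g x), hC x, hC y])
  rw [dist_eq_norm] at h
  have h2 := norm_le_norm_add_norm_sub' ((convolution ((b k).normed volume) g (lsmul ℝ ℝ) volume) x) (g x)
  linarith [hC x]

open ContinuousLinearMap MeasureTheory in
lemma mollify (Ω : Set 𝔼) (hΩ : IsOpen Ω) (φ : 𝔼 → ℝ) (hφ : ContDiff ℝ 1 φ)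
    (hφc : HasCompactSupport φ) (hφs : tsupport φ ⊆ Ω) :
    ∃ ψ : ℕ → 𝔼 → ℝ, (∀ k, IsTestFun n Ω (ψ k)) ∧
      (∃ C : ℝ, ∀ k x, |ψ k x| ≤ C ∧ ‖gradient (ψ k) x‖ ≤ C) ∧
      ∀ x, Filter.Tendsto (fun k => ψ k x) Filter.atTop (𝓝 (φ x)) ∧
        Filter.Tendsto (fun k => gradient (ψ k) x) Filter.atTop (𝓝 (gradient φ x)) := by
  obtain ⟨δ, hδ, hδΩ⟩ := IsCompact.exists_cthickening_subset_open hφc hΩ hφs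
  let b : ℕ → ContDiffBump (0 : 𝔼) := fun k =>
    { rIn := δ / (k + 1) / 2, rOut := δ / (k + 1), rIn_pos := by positivity,
      rIn_lt_rOut := by
        have : 0 < δ / ((k:ℝ) + 1) := by positivity
        linarith }
  have hb : Filter.Tendsto (fun k => (b k).rOut) Filter.atTop (𝓝 0) := by
    have := (tendsto_one_div_add_atTop_nhds_zero_nat (𝕜 := ℝ)).const_mul δ
    simpa [b, div_eq_mul_inv] using this
  set ψ : ℕ → 𝔼 → ℝ := fun k => convolution ((b k).normed volume) φ (lsmul ℝ ℝ) volume with hψ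
  obtain ⟨⟨C1, hC1⟩, ht1⟩ := mollify_aux φ hφ.continuous hφc b hb
  obtain ⟨⟨C2, hC2⟩, ht2⟩ := mollify_aux (fderiv ℝ φ) (hφ.continuous_fderiv one_ne_zero)
    (hφc.fderiv ℝ) b hb
  have hli : ∀ k, LocallyIntegrable ((b k).normed volume) (volume : Measure 𝔼) := fun k =>
    ((b k).continuous_normed).locallyIntegrable
  have hfd : ∀ k x, fderiv ℝ (ψ k) x =
      (convolution ((b k).normed volume) (fderiv ℝ φ) (lsmul ℝ ℝ) volume) x := by
    intro k x
    rw [(hφc.hasFDerivAt_convolution_right (lsmul ℝ ℝ) (hli k) hφ x).fderiv]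
    unfold convolution
    congr 1
  have hgr : ∀ k x, gradient (ψ k) x = (InnerProductSpace.toDual ℝ 𝔼).symm
      ((convolution ((b k).normed volume) (fderiv ℝ φ) (lsmul ℝ ℝ) volume) x) := by
    intro k x; rw [gradient, hfd]
  have hsup : ∀ k, Function.support (ψ k) ⊆ cthickening δ (tsupport φ) := by
    intro k x hx
    have := support_convolution_subset (lsmul ℝ ℝ) (μ := (volume : Measure 𝔼)) hx
    obtain ⟨y, hy, z, hz, rfl⟩ := this
    rw [ContDiffBump.support_normed_eq, mem_ball, dist_zero_right] at hy
    have hle : (b k).rOut ≤ δ := by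
      simp only [b]
      apply div_le_self hδ.le
      have : (0:ℝ) ≤ k := Nat.cast_nonneg k
      linarith
    refine mem_cthickening_of_dist_le _ z _ _ (subset_tsupport _ hz) ?_
    simp only [dist_eq_norm, add_sub_cancel_right]
    linarith
  refine ⟨ψ, ?_, ⟨max C1 C2, ?_⟩, ?_⟩
  · intro k
    refine ⟨?_, ?_, ?_⟩
    · exact (b k).hasCompactSupport_normed.contDiff_convolution_left (lsmul ℝ ℝ)
        (b k).contDiff_normed hφ.continuous.locallyIntegrable
    · exact HasCompactSupport.of_support_subset_isCompact hφc.isCompact.cthickening (hsup k)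
    · exact (closure_minimal (hsup k) isClosed_cthickening).trans hδΩ
  · intro k x
    refine ⟨(hC1 k x).trans (le_max_left _ _), ?_⟩
    rw [hgr, LinearIsometryEquiv.norm_map]
    exact (hC2 k x).trans (le_max_right _ _)
  · intro x
    refine ⟨ht1 x, ?_⟩
    simp_rw [hgr]
    exact ((InnerProductSpace.toDual ℝ 𝔼).symm.continuous.tendsto _).comp (ht2 x)

noncomputable def Hf (s : ℝ) : ℝ := s * Real.smoothTransition (s - 1)

lemma Hf_contDiff : ContDiff ℝ 1 Hf := by
  unfold Hf
  exact contDiff_id.mul (Real.smoothTransition.contDiff.comp (contDiff_id.sub contDiff_const))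

lemma Hf_of_le {s : ℝ} (h : s ≤ 1) : Hf s = 0 := by
  simp [Hf, Real.smoothTransition.zero_of_nonpos (show s - 1 ≤ 0 by linarith)]

lemma Hf_of_ge {s : ℝ} (h : 2 ≤ s) : Hf s = s := by
  simp [Hf, Real.smoothTransition.one_of_one_le (show 1 ≤ s - 1 by linarith)]

lemma Hf_nonneg {s : ℝ} (h : 0 ≤ s) : 0 ≤ Hf s := mul_nonneg h (Real.smoothTransition.nonneg _)

lemma Hf_le {s : ℝ} (h : 0 ≤ s) : Hf s ≤ s :=
  mul_le_of_le_one_right h (Real.smoothTransition.le_one _)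

lemma Hf_deriv_of_gt {s : ℝ} (h : 2 < s) : deriv Hf s = 1 := by
  have : Hf =ᶠ[𝓝 s] id := by
    filter_upwards [lt_mem_nhds h] with y hy using Hf_of_ge hy.le
  rw [this.deriv_eq]; simp

lemma Hf_deriv_bdd : ∃ C : ℝ, ∀ s, |deriv Hf s| ≤ C := by
  obtain ⟨C, hC⟩ := (isCompact_Icc (a := (1:ℝ)) (b := 2)).exists_bound_of_continuousOn
    (Hf_contDiff.continuous_deriv le_rfl).continuousOn
  refine ⟨max C 1, fun s => ?_⟩
  rcases lt_or_ge s 1 with h | h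
  · have : Hf =ᶠ[𝓝 s] fun _ => (0:ℝ) := by
      filter_upwards [gt_mem_nhds h] with y hy using Hf_of_le hy.le
    rw [this.deriv_eq]; simp
  · rcases lt_or_ge 2 s with h2 | h2
    · rw [Hf_deriv_of_gt h2]; simp
    · exact (hC s ⟨h, h2⟩).trans (le_max_left _ _)

lemma trunc (Ω : Set 𝔼) (hΩ : IsOpen Ω) (hΩb : IsBounded Ω) (w : 𝔼 → ℝ)
    (hwc : ContinuousOn w (closure Ω)) (hw1 : ContDiffOn ℝ 1 w Ω)
    (hw0 : ∀ x ∈ closure Ω, 0 ≤ w x) (hwb : ∀ x ∈ frontier Ω, w x = 0) :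
    ∃ (v : ℕ → 𝔼 → ℝ) (C : ℝ), ∀ k, (ContDiff ℝ 1 (v k) ∧ HasCompactSupport (v k) ∧
        tsupport (v k) ⊆ Ω ∧ (∀ x, 0 ≤ v k x) ∧
        (∀ x ∈ Ω, v k x ≤ w x ∧ ‖gradient (v k) x‖ ≤ C * ‖gradient w x‖)) ∧
      ∀ x ∈ Ω, ∀ᶠ k in Filter.atTop, v k x = w x ∧ gradient (v k) x = gradient w x := by
  obtain ⟨C, hC⟩ := Hf_deriv_bdd
  set h : ℕ → ℝ → ℝ := fun k t => (1 / ((k:ℝ) + 1)) * Hf (((k:ℝ) + 1) * t) with hh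
  have hk0 : ∀ k : ℕ, (0:ℝ) < k + 1 := fun k => by positivity
  have hhd : ∀ k t, HasDerivAt (h k) (deriv Hf (((k:ℝ) + 1) * t)) t := by
    intro k t
    have h1 : HasDerivAt Hf (deriv Hf (((k:ℝ) + 1) * t)) (((k:ℝ) + 1) * t) :=
      (Hf_contDiff.differentiable one_ne_zero _).hasDerivAt
    have h2 : HasDerivAt (fun t : ℝ => ((k:ℝ) + 1) * t) ((k:ℝ) + 1) t := by
      simpa using (hasDerivAt_id t).const_mul ((k:ℝ) + 1)
    have h3 := (h1.comp t h2).const_mul (1 / ((k:ℝ) + 1))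
    rw [mul_comm (deriv Hf _), ← mul_assoc, one_div_mul_cancel (hk0 k).ne', one_mul] at h3
    exact h3
  have hhc : ∀ k, ContDiff ℝ 1 (h k) := fun k =>
    contDiff_const.mul (Hf_contDiff.comp (contDiff_const.mul contDiff_id))
  have hh0 : ∀ (k : ℕ) (t : ℝ), t ≤ 1 / ((k:ℝ) + 1) → h k t = 0 := by
    intro k t ht
    simp only [hh]
    rw [Hf_of_le, mul_zero]
    rwa [le_div_iff₀' (hk0 k)] at ht
  set v : ℕ → 𝔼 → ℝ := fun k => Ω.indicator (fun x => h k (w x)) with hv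
  have hev : ∀ k, ∀ x ∈ Ω, v k =ᶠ[𝓝 x] (fun x => h k (w x)) := by
    intro k x hx
    filter_upwards [hΩ.mem_nhds hx] with y hy
    simp [hv, hy]
  have hgrad : ∀ k, ∀ x ∈ Ω, gradient (v k) x = deriv Hf (((k:ℝ) + 1) * w x) • gradient w x := by
    intro k x hx
    have hd : DifferentiableAt ℝ w x :=
      (hw1.differentiableOn one_ne_zero).differentiableAt (hΩ.mem_nhds hx)
    have := (hhd k (w x)).comp_hasFDerivAt x hd.hasFDerivAt
    rw [gradient, (hev k x hx).fderiv_eq]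
    rw [show (fun x => h k (w x)) = h k ∘ w from rfl, this.fderiv, map_smul]
    rfl
  -- the compact set
  have hSc : ∀ k : ℕ, IsCompact (closure Ω ∩ w ⁻¹' (Ici (1 / ((k:ℝ) + 1)))) := fun k =>
    (hΩb.isCompact_closure).of_isClosed_subset
      (hwc.preimage_isClosed_of_isClosed isClosed_closure isClosed_Ici) inter_subset_left
  have hSΩ : ∀ k : ℕ, closure Ω ∩ w ⁻¹' (Ici (1 / ((k:ℝ) + 1))) ⊆ Ω := by
    rintro k x ⟨hx1, hx2⟩
    by_contra hx
    have : x ∈ frontier Ω := by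
      rw [frontier, hΩ.interior_eq]; exact ⟨hx1, hx⟩
    have h0 := hwb x this
    simp only [mem_preimage, mem_Ici, h0] at hx2
    have : 0 < 1 / ((k:ℝ) + 1) := by positivity
    linarith
  have hsup : ∀ k, Function.support (v k) ⊆ closure Ω ∩ w ⁻¹' (Ici (1 / ((k:ℝ) + 1))) := by
    intro k x hx
    have hxΩ : x ∈ Ω := by
      by_contra hcon
      exact hx (by simp [hv, hcon])
    refine ⟨subset_closure hxΩ, ?_⟩
    by_contra hcon
    simp only [mem_preimage, mem_Ici, not_le] at hcon
    exact hx (by simp [hv, hxΩ, hh0 k _ hcon.le])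
  have htsup : ∀ k, tsupport (v k) ⊆ Ω := fun k =>
    (closure_minimal (hsup k) (hSc k).isClosed).trans (hSΩ k)
  refine ⟨v, C, fun k => ⟨⟨?_, ?_, htsup k, ?_, ?_⟩, ?_⟩⟩
  · rw [contDiff_iff_contDiffAt]
    intro x
    by_cases hx : x ∈ Ω
    · have h1 : ContDiffAt ℝ 1 w x := hw1.contDiffAt (hΩ.mem_nhds hx)
      exact ((hhc k).contDiffAt.comp x h1).congr_of_eventuallyEq (hev k x hx)
    · have : x ∉ tsupport (v k) := fun h => hx (htsup k h)
      rw [notMem_tsupport_iff_eventuallyEq] at this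
      exact contDiffAt_const.congr_of_eventuallyEq this
  · exact HasCompactSupport.of_support_subset_isCompact (hSc k) (hsup k)
  · intro x
    refine indicator_nonneg (fun y hy => ?_) x
    exact mul_nonneg (by positivity)
      (Hf_nonneg (mul_nonneg (hk0 k).le (hw0 y (subset_closure hy))))
  · intro x hx
    refine ⟨?_, ?_⟩
    · simp only [hv, indicator_of_mem hx, hh]
      have := Hf_le (mul_nonneg (hk0 k).le (hw0 x (subset_closure hx)))
      rw [one_div, inv_mul_le_iff₀ (hk0 k)]
      exact this
    · rw [hgrad k x hx, norm_smul]
      gcongr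
      exact hC _
  · intro x hx
    rcases (hw0 x (subset_closure hx)).eq_or_lt with h0 | hpos
    · refine Filter.Eventually.of_forall fun j => ?_
      have hmin : IsLocalMin w x := by
        filter_upwards [hΩ.mem_nhds hx] with y hy
        rw [← h0]; exact hw0 y (subset_closure hy)
      have hg0 : gradient w x = 0 := by rw [gradient, hmin.fderiv_eq_zero, map_zero]
      refine ⟨?_, by rw [hgrad j x hx, hg0, smul_zero]⟩
      simp [hv, hx, ← h0, hh, Hf]
    · obtain ⟨N, hN⟩ := exists_nat_gt (2 / w x)
      filter_upwards [Filter.eventually_ge_atTop N] with j hj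
      have hj' : 2 < ((j:ℝ) + 1) * w x := by
        rw [div_lt_iff₀ hpos] at hN
        have : (N:ℝ) ≤ j := by exact_mod_cast hj
        nlinarith
      refine ⟨?_, by rw [hgrad j x hx, Hf_deriv_of_gt hj', one_smul]⟩
      simp only [hv, indicator_of_mem hx, hh, Hf_of_ge hj'.le]
      have := (hk0 j).ne'
      field_simp

lemma gauss_compare (Ω : Set 𝔼) (hΩ : MeasurableSet Ω) (hΩb : IsBounded Ω) :
    ∃ a b : ENNReal, a ≠ ⊤ ∧ b ≠ ⊤ ∧
      (gaussianMeasure n).restrict Ω ≤ b • (volume : Measure 𝔼).restrict Ω ∧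
      (volume : Measure 𝔼).restrict Ω ≤ a • (gaussianMeasure n).restrict Ω := by
  obtain ⟨R, hR⟩ := hΩb.subset_closedBall (0 : 𝔼)
  set c : ℝ := (2 * π) ^ (-(n : ℝ) / 2) with hc
  have hc0 : 0 < c := by positivity
  set m : ENNReal := ENNReal.ofReal (c * Real.exp (-R ^ 2 / 2)) with hm
  have hm0 : m ≠ 0 := by
    rw [hm]; simp only [ne_eq, ENNReal.ofReal_eq_zero, not_le]; positivity
  have hmt : m ≠ ⊤ := ENNReal.ofReal_ne_top
  have hμ : (gaussianMeasure n).restrict Ω = ((volume : Measure 𝔼).restrict Ω).withDensity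
      (fun x => ENNReal.ofReal (c * Real.exp (-‖x‖ ^ 2 / 2))) := by
    rw [gaussianMeasure, restrict_withDensity hΩ]
  refine ⟨m⁻¹, ENNReal.ofReal c, ENNReal.inv_ne_top.2 hm0, ENNReal.ofReal_ne_top, ?_, ?_⟩
  · rw [hμ, ← withDensity_const]
    refine withDensity_mono (Filter.Eventually.of_forall fun x => ?_)
    apply ENNReal.ofReal_le_ofReal
    refine mul_le_of_le_one_right hc0.le ?_
    rw [Real.exp_le_one_iff]
    have := sq_nonneg ‖x‖
    linarith
  · have h1 : m • (volume : Measure 𝔼).restrict Ω ≤ (gaussianMeasure n).restrict Ω := by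
      rw [hμ, ← withDensity_const]
      refine withDensity_mono ?_
      filter_upwards [ae_restrict_mem hΩ] with x hx
      apply ENNReal.ofReal_le_ofReal
      have hx' := hR hx
      rw [mem_closedBall_zero_iff] at hx'
      have : ‖x‖ ^ 2 ≤ R ^ 2 := by gcongr
      gcongr
    calc (volume : Measure 𝔼).restrict Ω = m⁻¹ • (m • (volume : Measure 𝔼).restrict Ω) := by
          rw [smul_smul, ENNReal.inv_mul_cancel hm0 hmt, one_smul]
      _ ≤ _ := by
        intro s
        have := h1 s
        simp only [Measure.smul_apply, smul_eq_mul] at this ⊢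
        gcongr
end Approx

section EigSec
variable {n : ℕ}
local notation "𝔼" => EuclideanSpace ℝ (Fin n)

structure Eig (n : ℕ) (p : ℝ) (Ω : Set (EuclideanSpace ℝ (Fin n)))
    (u : EuclideanSpace ℝ (Fin n) → ℝ) (M : ℝ) : Prop where
  hp : 1 < p
  ho : IsOpen Ω
  hb : IsBounded Ω
  hc : Convex ℝ Ω
  hne : Ω.Nonempty
  hu0 : ContinuousOn u (closure Ω)
  hu1 : ContDiffOn ℝ 1 u Ω
  hpos : ∀ x ∈ Ω, 0 < u x
  hub : ∀ x ∈ frontier Ω, u x = 0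
  hM : 0 < M
  huM : ∀ x ∈ Ω, u x ≤ M
  hgM : ∀ x ∈ Ω, ‖gradient u x‖ ≤ M
  hnorm : (∫ x in Ω, u x ^ p ∂(gaussianMeasure n)) = 1
  heig : ∀ φ : EuclideanSpace ℝ (Fin n) → ℝ, IsTestFun n Ω φ →
      ∫ x in Ω, ‖gradient u x‖ ^ (p - 2) * ⟪gradient u x, gradient φ x⟫ ∂(gaussianMeasure n)
        = lambdaPGamma n p Ω * ∫ x in Ω, u x ^ (p - 1) * φ x ∂(gaussianMeasure n)

structure C1c (Ω : Set 𝔼) (v : 𝔼 → ℝ) : Prop where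
  c1 : ContDiff ℝ 1 v
  cs : HasCompactSupport v
  ts : tsupport v ⊆ Ω

lemma gauss_finite {Ω : Set 𝔼} (hΩ : MeasurableSet Ω) (hΩb : IsBounded Ω) :
    IsFiniteMeasure ((gaussianMeasure n).restrict Ω) := by
  obtain ⟨a, b, -, hb, h, -⟩ := gauss_compare Ω hΩ hΩb
  refine ⟨(h univ).trans_lt ?_⟩
  simp only [Measure.smul_apply, Measure.restrict_apply_univ, smul_eq_mul]
  exact ENNReal.mul_lt_top hb.lt_top hΩb.measure_lt_top

lemma continuous_gradient {v : 𝔼 → ℝ} (hv : ContDiff ℝ 1 v) : Continuous (gradient v) := by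
  unfold gradient
  exact (LinearIsometryEquiv.continuous _).comp (hv.continuous_fderiv one_ne_zero)

lemma C1c.bdd {Ω : Set 𝔼} {v : 𝔼 → ℝ} (h : C1c Ω v) :
    ∃ C : ℝ, ∀ x, |v x| ≤ C ∧ ‖gradient v x‖ ≤ C := by
  obtain ⟨C1, h1⟩ := h.c1.continuous.bounded_above_of_compact_support h.cs
  obtain ⟨C2, h2⟩ := (h.c1.continuous_fderiv one_ne_zero).bounded_above_of_compact_support
    (h.cs.fderiv ℝ)
  refine ⟨max C1 C2, fun x => ⟨(h1 x).trans (le_max_left _ _), ?_⟩⟩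
  rw [gradient, LinearIsometryEquiv.norm_map]
  exact (h2 x).trans (le_max_right _ _)

lemma zrpow {z p : ℝ} (hz : 0 ≤ z) (hp : 1 < p) : z ^ (p - 2) * z ^ 2 = z ^ p := by
  rcases hz.eq_or_lt with rfl | h
  · rw [Real.zero_rpow (by linarith : p ≠ 0)]; simp
  · exact rpow_sub_two_mul_sq h

lemma plap_bound {p : ℝ} (ζ ξ : 𝔼) :
    |‖ζ‖ ^ (p - 2) * ⟪ζ, ξ⟫| ≤ ‖ζ‖ ^ (p - 1) * ‖ξ‖ := by
  rcases eq_or_ne ζ 0 with rfl | h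
  · simp; positivity
  · have hz : 0 < ‖ζ‖ := norm_pos_iff.2 h
    rw [abs_mul, abs_of_nonneg (by positivity)]
    calc _ ≤ ‖ζ‖ ^ (p - 2) * (‖ζ‖ * ‖ξ‖) := by gcongr; exact abs_real_inner_le_norm _ _
      _ = _ := by
        rw [← mul_assoc, ← Real.rpow_add_one hz.ne']; congr 2; ring

variable {p M : ℝ} {Ω : Set (EuclideanSpace ℝ (Fin n))} {u : EuclideanSpace ℝ (Fin n) → ℝ}

lemma Eig.umeas (H : Eig n p Ω u M) : AEMeasurable u ((gaussianMeasure n).restrict Ω) :=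
  H.hu1.continuousOn.aemeasurable H.ho.measurableSet

lemma plap_meas {g : 𝔼 → 𝔼} {μ : Measure 𝔼} (hg : AEMeasurable g μ) :
    AEStronglyMeasurable (fun x => ‖gradient u x‖ ^ (p - 2) * ⟪gradient u x, g x⟫) μ := by
  have h1 := (measurable_gradient u).aemeasurable (μ := μ)
  exact ((h1.norm.pow_const (p - 2)).mul (h1.inner hg)).aestronglyMeasurable

lemma Eig.plap_le (H : Eig n p Ω u M) {x : 𝔼} (hx : x ∈ Ω) {ξ : 𝔼} {C : ℝ} (hξ : ‖ξ‖ ≤ C) :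
    ‖‖gradient u x‖ ^ (p - 2) * ⟪gradient u x, ξ⟫‖ ≤ M ^ (p - 1) * C := by
  refine (plap_bound _ _).trans ?_
  have := H.hp
  have := H.hgM x hx
  have := H.hM
  gcongr

lemma Eig.upow_le (H : Eig n p Ω u M) {x : 𝔼} (hx : x ∈ Ω) : ‖u x ^ (p - 1)‖ ≤ M ^ (p - 1) := by
  have := (H.hpos x hx).le
  rw [Real.norm_of_nonneg (by positivity)]
  exact Real.rpow_le_rpow this (H.huM x hx) (by linarith [H.hp])

lemma Eig.dct (H : Eig n p Ω u M) (ψ : ℕ → 𝔼 → ℝ) (φ : 𝔼 → ℝ) (g : 𝔼 → 𝔼) (C : ℝ)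
    (hm : ∀ k, AEMeasurable (ψ k) ((gaussianMeasure n).restrict Ω))
    (hC : ∀ k, ∀ x ∈ Ω, |ψ k x| ≤ C ∧ ‖gradient (ψ k) x‖ ≤ C)
    (h1 : ∀ x ∈ Ω, Filter.Tendsto (fun k => ψ k x) Filter.atTop (𝓝 (φ x)))
    (h2 : ∀ x ∈ Ω, Filter.Tendsto (fun k => gradient (ψ k) x) Filter.atTop (𝓝 (g x)))
    (hw : ∀ k, ∫ x in Ω, ‖gradient u x‖ ^ (p - 2) * ⟪gradient u x, gradient (ψ k) x⟫
        ∂(gaussianMeasure n)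
        = lambdaPGamma n p Ω * ∫ x in Ω, u x ^ (p - 1) * ψ k x ∂(gaussianMeasure n)) :
    ∫ x in Ω, ‖gradient u x‖ ^ (p - 2) * ⟪gradient u x, g x⟫ ∂(gaussianMeasure n)
        = lambdaPGamma n p Ω * ∫ x in Ω, u x ^ (p - 1) * φ x ∂(gaussianMeasure n) := by
  have := gauss_finite H.ho.measurableSet H.hb
  have hmem := ae_restrict_mem (μ := gaussianMeasure n) H.ho.measurableSet
  have t1 := tendsto_integral_of_dominated_convergence
    (μ := (gaussianMeasure n).restrict Ω)
    (F := fun k x => ‖gradient u x‖ ^ (p - 2) * ⟪gradient u x, gradient (ψ k) x⟫)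
    (f := fun x => ‖gradient u x‖ ^ (p - 2) * ⟪gradient u x, g x⟫)
    (fun _ => M ^ (p - 1) * C)
    (fun k => plap_meas (measurable_gradient _).aemeasurable) (integrable_const _)
    (fun k => by
      filter_upwards [hmem] with x hx using H.plap_le hx (hC k x hx).2)
    (by
      filter_upwards [hmem] with x hx
      exact ((tendsto_const_nhds (x := gradient u x)).inner (h2 x hx)).const_mul _)
  have t2 := tendsto_integral_of_dominated_convergence
    (μ := (gaussianMeasure n).restrict Ω)
    (F := fun k x => u x ^ (p - 1) * ψ k x)
    (f := fun x => u x ^ (p - 1) * φ x)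
    (fun _ => M ^ (p - 1) * C)
    (fun k => ((H.umeas.pow_const _).mul (hm k)).aestronglyMeasurable) (integrable_const _)
    (fun k => by
      filter_upwards [hmem] with x hx
      rw [norm_mul]
      have := H.hM
      exact mul_le_mul (H.upow_le hx) (hC k x hx).1 (norm_nonneg _) (by positivity))
    (by
      filter_upwards [hmem] with x hx
      exact (h1 x hx).const_mul _)
  refine tendsto_nhds_unique t1 ?_
  simp_rw [hw]
  exact t2.const_mul _

lemma Eig.weak (H : Eig n p Ω u M) {φ : 𝔼 → ℝ} (hφ : C1c Ω φ) :
    ∫ x in Ω, ‖gradient u x‖ ^ (p - 2) * ⟪gradient u x, gradient φ x⟫ ∂(gaussianMeasure n)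
        = lambdaPGamma n p Ω * ∫ x in Ω, u x ^ (p - 1) * φ x ∂(gaussianMeasure n) := by
  obtain ⟨ψ, h1, ⟨C, hC⟩, h2⟩ := mollify Ω H.ho φ hφ.c1 hφ.cs hφ.ts
  exact H.dct ψ φ (gradient φ) C (fun k => (h1 k).1.continuous.aemeasurable)
    (fun k x _ => hC k x) (fun x _ => (h2 x).1) (fun x _ => (h2 x).2) (fun k => H.heig _ (h1 k))

lemma Eig.nonneg_cl (H : Eig n p Ω u M) : ∀ x ∈ closure Ω, 0 ≤ u x := by
  intro x hx
  by_cases h : x ∈ Ω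
  · exact (H.hpos x h).le
  · exact (H.hub x (by rw [frontier, H.ho.interior_eq]; exact ⟨hx, h⟩)).ge

lemma Eig.energy (H : Eig n p Ω u M) :
    ∫ x in Ω, ‖gradient u x‖ ^ p ∂(gaussianMeasure n) = lambdaPGamma n p Ω := by
  obtain ⟨v, C, hv⟩ := trunc Ω H.ho H.hb u H.hu0 H.hu1 H.nonneg_cl H.hub
  have h := H.dct v u (gradient u) (max M (|C| * M))
    (fun k => (hv k).1.1.continuous.aemeasurable)
    (fun k x hx => by
      obtain ⟨h1, h2⟩ := (hv k).1.2.2.2.2 x hx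
      have h3 := (hv k).1.2.2.2.1 x
      refine ⟨?_, ?_⟩
      · rw [abs_of_nonneg h3]; exact (h1.trans (H.huM x hx)).trans (le_max_left _ _)
      · refine (h2.trans ?_).trans (le_max_right _ _)
        have := H.hgM x hx
        have := le_abs_self C
        gcongr)
    (fun x hx => tendsto_const_nhds.congr'
      (((hv 0).2 x hx).mono fun k hk => hk.1.symm))
    (fun x hx => tendsto_const_nhds.congr'
      (((hv 0).2 x hx).mono fun k hk => hk.2.symm))
    (fun k => H.weak ⟨(hv k).1.1, (hv k).1.2.1, (hv k).1.2.2.1⟩)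
  have e1 : ∫ x in Ω, ‖gradient u x‖ ^ (p - 2) * ⟪gradient u x, gradient u x⟫ ∂(gaussianMeasure n)
      = ∫ x in Ω, ‖gradient u x‖ ^ p ∂(gaussianMeasure n) := by
    congr 1; ext x
    rw [real_inner_self_eq_norm_sq, zrpow (norm_nonneg _) H.hp]
  have e2 : ∫ x in Ω, u x ^ (p - 1) * u x ∂(gaussianMeasure n) = 1 := by
    refine Eq.trans ?_ H.hnorm
    refine setIntegral_congr_fun H.ho.measurableSet fun x hx => ?_
    rw [← Real.rpow_add_one (H.hpos x hx).ne']; congr 1; ring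
  rw [← e1, h, e2, mul_one]

lemma Eig.lam_nonneg (H : Eig n p Ω u M) : 0 ≤ lambdaPGamma n p Ω := by
  rw [← H.energy]; exact integral_nonneg fun x => by positivity

lemma C1c.int_grad (hp : 1 < p) (hΩ : MeasurableSet Ω) (hb : IsBounded Ω) {v : 𝔼 → ℝ}
    (hv : C1c Ω v) :
    Integrable (fun x => ‖gradient v x‖ ^ p) ((gaussianMeasure n).restrict Ω) := by
  have := gauss_finite hΩ hb
  obtain ⟨C, hC⟩ := hv.bdd
  refine Integrable.of_bound
    (((measurable_gradient v).norm.pow_const p).aestronglyMeasurable) (C ^ p) ?_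
  filter_upwards with x
  rw [Real.norm_of_nonneg (by positivity)]
  have := (hC x).2
  gcongr

lemma C1c.int_pow (hp : 1 < p) (hΩ : MeasurableSet Ω) (hb : IsBounded Ω) {v : 𝔼 → ℝ}
    (hv : C1c Ω v) (h0 : ∀ x, 0 ≤ v x) :
    Integrable (fun x => v x ^ p) ((gaussianMeasure n).restrict Ω) := by
  have := gauss_finite hΩ hb
  obtain ⟨C, hC⟩ := hv.bdd
  refine Integrable.of_bound
    ((hv.c1.continuous.measurable.pow_const p).aestronglyMeasurable) (C ^ p) ?_
  filter_upwards with x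
  have h1 := h0 x
  rw [Real.norm_of_nonneg (by positivity)]
  have := (le_abs_self _).trans (hC x).1
  gcongr

lemma Eig.int_plap (H : Eig n p Ω u M) {φ : 𝔼 → ℝ} (hφ : C1c Ω φ) :
    Integrable (fun x => ‖gradient u x‖ ^ (p - 2) * ⟪gradient u x, gradient φ x⟫)
      ((gaussianMeasure n).restrict Ω) := by
  have := gauss_finite H.ho.measurableSet H.hb
  obtain ⟨C, hC⟩ := hφ.bdd
  refine Integrable.of_bound (plap_meas (measurable_gradient _).aemeasurable)
    (M ^ (p - 1) * C) ?_
  filter_upwards [ae_restrict_mem (μ := gaussianMeasure n) H.ho.measurableSet] with x hx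
    using H.plap_le hx (hC x).2

lemma Eig.int_gradu (H : Eig n p Ω u M) :
    Integrable (fun x => ‖gradient u x‖ ^ p) ((gaussianMeasure n).restrict Ω) := by
  have := gauss_finite H.ho.measurableSet H.hb
  have := H.hp
  refine Integrable.of_bound
    (((measurable_gradient u).norm.pow_const p).aestronglyMeasurable) (M ^ p) ?_
  filter_upwards [ae_restrict_mem (μ := gaussianMeasure n) H.ho.measurableSet] with x hx
  rw [Real.norm_of_nonneg (by positivity)]
  have := H.hgM x hx
  gcongr

lemma Eig.breg_u (H : Eig n p Ω u M) {v : 𝔼 → ℝ} (hv : C1c Ω v) :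
    Integrable (fun x => breg p (gradient v x) (gradient u x)) ((gaussianMeasure n).restrict Ω) ∧
    ∫ x in Ω, breg p (gradient v x) (gradient u x) ∂(gaussianMeasure n) =
      ∫ x in Ω, ‖gradient v x‖ ^ p ∂(gaussianMeasure n) + (p - 1) * lambdaPGamma n p Ω
      - p * (lambdaPGamma n p Ω * ∫ x in Ω, u x ^ (p - 1) * v x ∂(gaussianMeasure n)) := by
  have e : ∀ x, breg p (gradient v x) (gradient u x) = ‖gradient v x‖ ^ p
      + (p - 1) * ‖gradient u x‖ ^ p
      - p * (‖gradient u x‖ ^ (p - 2) * ⟪gradient u x, gradient v x⟫) := by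
    intro x
    rw [breg, inner_sub_right, real_inner_self_eq_norm_sq, mul_sub, zrpow (norm_nonneg _) H.hp]
    ring
  have i1 := hv.int_grad H.hp H.ho.measurableSet H.hb
  have i2 := H.int_gradu.const_mul (p - 1)
  have i3 := (H.int_plap hv).const_mul p
  simp_rw [e]
  refine ⟨(i1.add i2).sub i3, ?_⟩
  rw [integral_sub (f := fun x => ‖gradient v x‖ ^ p + (p - 1) * ‖gradient u x‖ ^ p) (i1.add i2) i3, integral_add i1 i2, integral_const_mul, integral_const_mul,
    H.energy, H.weak hv]

lemma Eig.picone_c1c (H : Eig n p Ω u M) {v : 𝔼 → ℝ} (hv : C1c Ω v) (h0 : ∀ x, 0 ≤ v x) :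
    C1c Ω (fun x => v x ^ p * u x ^ (1 - p)) := by
  have hp0 : p ≠ 0 := by linarith [H.hp]
  have hsub : Function.support (fun x => v x ^ p * u x ^ (1 - p)) ⊆ Function.support v := by
    intro x hx hvx
    apply hx
    simp [show v x = 0 from hvx, Real.zero_rpow hp0]
  refine ⟨?_, ?_, ?_⟩
  · rw [contDiff_iff_contDiffAt]
    intro x
    by_cases hx : x ∈ Ω
    · have h1 : ContDiff ℝ 1 (fun x => v x ^ p) := by
        have := hv.c1.norm_rpow H.hp
        convert this using 2 with x
        rw [Real.norm_of_nonneg (h0 x)]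
      have h2 : ContDiffAt ℝ 1 (fun x => u x ^ (1 - p)) x :=
        (H.hu1.contDiffAt (H.ho.mem_nhds hx)).rpow_const_of_ne (H.hpos x hx).ne'
      exact h1.contDiffAt.mul h2
    · have hx' : x ∉ tsupport v := fun h => hx (hv.ts h)
      rw [notMem_tsupport_iff_eventuallyEq] at hx'
      refine (contDiffAt_const (c := (0:ℝ))).congr_of_eventuallyEq ?_
      filter_upwards [hx'] with y hy
      simp [hy, Real.zero_rpow hp0]
  · exact HasCompactSupport.of_support_subset_isCompact hv.cs.isCompact
      (hsub.trans (subset_tsupport v))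
  · exact (closure_mono hsub).trans hv.ts

lemma Eig.picone_pt (H : Eig n p Ω u M) {v : 𝔼 → ℝ} (hv : C1c Ω v) (h0 : ∀ x, 0 ≤ v x)
    {x : 𝔼} (hx : x ∈ Ω) :
    breg p (gradient v x) ((v x / u x) • gradient u x) = ‖gradient v x‖ ^ p -
      ‖gradient u x‖ ^ (p - 2) *
        ⟪gradient u x, gradient (fun x => v x ^ p * u x ^ (1 - p)) x⟫ := by
  have hp := H.hp
  have hu := H.hpos x hx
  have hdu : DifferentiableAt ℝ u x :=
    (H.hu1.differentiableOn one_ne_zero).differentiableAt (H.ho.mem_nhds hx)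
  have hdv : DifferentiableAt ℝ v x := hv.c1.differentiable one_ne_zero x
  have h1 := hdv.hasFDerivAt.rpow_const (p := p) (Or.inr hp.le)
  have h2 := hdu.hasFDerivAt.rpow_const (p := 1 - p) (Or.inl hu.ne')
  have h3 : HasFDerivAt (fun x => v x ^ p * u x ^ (1 - p)) _ x := h1.mul h2
  have hg : gradient (fun x => v x ^ p * u x ^ (1 - p)) x =
      (v x ^ p * ((1 - p) * u x ^ (1 - p - 1))) • gradient u x +
      (u x ^ (1 - p) * (p * v x ^ (p - 1))) • gradient v x := by
    rw [gradient, h3.fderiv, map_add, map_smul, map_smul, map_smul, map_smul, smul_smul, smul_smul]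
    rfl
  rw [hg, inner_add_right, real_inner_smul_right, real_inner_smul_right,
    real_inner_self_eq_norm_sq]
  set f := v x / u x with hf
  have hv0 := h0 x
  have hf0 : 0 ≤ f := by positivity
  have e1 : v x ^ p * u x ^ (1 - p - 1) = f ^ p := by
    rw [hf, Real.div_rpow hv0 hu.le, show 1 - p - 1 = -p by ring, Real.rpow_neg hu.le]
    rfl
  have e2 : u x ^ (1 - p) * v x ^ (p - 1) = f ^ (p - 1) := by
    rw [hf, Real.div_rpow hv0 hu.le, show 1 - p = -(p - 1) by ring, Real.rpow_neg hu.le]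
    rw [mul_comm]; rfl
  have hz := zrpow (norm_nonneg (gradient u x)) hp
  have hfz := zrpow hf0 hp
  have hfz1 : f ^ (p - 2) * f = f ^ (p - 1) ∨ f = 0 := by
    rcases hf0.eq_or_lt with h | h
    · right; exact h.symm
    · left; rw [← Real.rpow_add_one h.ne']; congr 1; ring
  rw [breg, norm_smul, Real.norm_of_nonneg hf0, inner_sub_right, real_inner_smul_left,
    real_inner_smul_left, real_inner_smul_right, real_inner_self_eq_norm_sq,
    Real.mul_rpow hf0 (norm_nonneg _), Real.mul_rpow hf0 (norm_nonneg _)]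
  set Z := ‖gradient u x‖ ^ (p - 2)
  set I := ⟪gradient u x, gradient v x⟫
  have e3 : v x ^ p * ((1 - p) * u x ^ (1 - p - 1)) = (1 - p) * f ^ p := by rw [← e1]; ring
  have e4 : u x ^ (1 - p) * (p * v x ^ (p - 1)) = p * f ^ (p - 1) := by rw [← e2]; ring
  rw [e3, e4, ← hz]
  have e5 : f ^ (p - 2) * f * I = f ^ (p - 1) * I := by
    rcases hfz1 with h | h
    · rw [h]
    · rw [h, Real.zero_rpow (by linarith : p - 1 ≠ 0)]; ring
  rw [← hfz] at *
  linear_combination (-p * Z) * e5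

lemma Eig.picone (H : Eig n p Ω u M) {v : 𝔼 → ℝ} (hv : C1c Ω v) (h0 : ∀ x, 0 ≤ v x) :
    Integrable (fun x => breg p (gradient v x) ((v x / u x) • gradient u x))
      ((gaussianMeasure n).restrict Ω) ∧
    ∫ x in Ω, breg p (gradient v x) ((v x / u x) • gradient u x) ∂(gaussianMeasure n) =
      ∫ x in Ω, ‖gradient v x‖ ^ p ∂(gaussianMeasure n)
      - lambdaPGamma n p Ω * ∫ x in Ω, v x ^ p ∂(gaussianMeasure n) := by
  have hφ := H.picone_c1c hv h0
  have i1 := hv.int_grad H.hp H.ho.measurableSet H.hb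
  have i2 := H.int_plap hφ
  have hae : (fun x => breg p (gradient v x) ((v x / u x) • gradient u x)) =ᵐ[
      (gaussianMeasure n).restrict Ω] fun x => ‖gradient v x‖ ^ p -
      ‖gradient u x‖ ^ (p - 2) *
        ⟪gradient u x, gradient (fun x => v x ^ p * u x ^ (1 - p)) x⟫ := by
    filter_upwards [ae_restrict_mem (μ := gaussianMeasure n) H.ho.measurableSet] with x hx
      using H.picone_pt hv h0 hx
  refine ⟨(integrable_congr hae).2 (i1.sub i2), ?_⟩
  rw [integral_congr_ae hae, integral_sub i1 i2, H.weak hφ]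
  congr 2
  refine setIntegral_congr_fun H.ho.measurableSet fun x hx => ?_
  have hu := H.hpos x hx
  rw [mul_left_comm, ← Real.rpow_add hu]
  simp
end EigSec

section SeqSec
variable {n : ℕ}
local notation "𝔼" => EuclideanSpace ℝ (Fin n)
variable {p M : ℝ} {Ω : Set (EuclideanSpace ℝ (Fin n))} {u : EuclideanSpace ℝ (Fin n) → ℝ}

lemma enorm_rpow_ofReal {F : Type*} [NormedAddCommGroup F] (x : F) {q : ℝ} (hq : 0 ≤ q) :
    ‖x‖ₑ ^ q = ENNReal.ofReal (‖x‖ ^ q) := by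
  rw [← ofReal_norm_eq_enorm, ENNReal.ofReal_rpow_of_nonneg (norm_nonneg _) hq]

lemma breg_tendsto (hp : 1 < p) {μ : Measure 𝔼} (ξ ζ : ℕ → 𝔼 → 𝔼) (B : ℝ)
    (h1 : ∀ k, Integrable (fun x => ‖ξ k x‖ ^ p) μ) (h2 : ∀ k, Integrable (fun x => ‖ζ k x‖ ^ p) μ)
    (hB1 : ∀ k, ∫ x, ‖ξ k x‖ ^ p ∂μ ≤ B) (hB2 : ∀ k, ∫ x, ‖ζ k x‖ ^ p ∂μ ≤ B)
    (h3 : ∀ k, Integrable (fun x => breg p (ξ k x) (ζ k x)) μ)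
    (h4 : Filter.Tendsto (fun k => ∫ x, breg p (ξ k x) (ζ k x) ∂μ) Filter.atTop (𝓝 0)) :
    Filter.Tendsto (fun k => ∫⁻ x, ‖ξ k x - ζ k x‖ₑ ^ p ∂μ) Filter.atTop (𝓝 0) := by
  have hB : 0 ≤ B := (integral_nonneg fun x => by positivity).trans (hB1 0)
  have key : ∀ η : ℝ, 0 < η → ∀ᶠ k in Filter.atTop,
      ∫⁻ x, ‖ξ k x - ζ k x‖ₑ ^ p ∂μ ≤ ENNReal.ofReal η := by
    intro η hη
    obtain ⟨C, hC0, hC⟩ := breg_key (F := 𝔼) hp (θ := η / (4 * (B + 1))) (by positivity)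
    have h5 := h4.const_mul C
    rw [mul_zero] at h5
    filter_upwards [h5.eventually (gt_mem_nhds (show (0:ℝ) < η / 2 by positivity))] with k hk
    set θ := η / (4 * (B + 1))
    have hI : Integrable (fun x => θ * (‖ξ k x‖ ^ p + ‖ζ k x‖ ^ p) + C * breg p (ξ k x) (ζ k x)) μ :=
      (((h1 k).add (h2 k)).const_mul θ).add ((h3 k).const_mul C)
    have hθ : 0 < θ := by positivity
    calc ∫⁻ x, ‖ξ k x - ζ k x‖ₑ ^ p ∂μ
        ≤ ∫⁻ x, ENNReal.ofReal
            (θ * (‖ξ k x‖ ^ p + ‖ζ k x‖ ^ p) + C * breg p (ξ k x) (ζ k x)) ∂μ := by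
          refine lintegral_mono fun x => ?_
          rw [enorm_rpow_ofReal _ (by linarith)]
          exact ENNReal.ofReal_le_ofReal (hC _ _)
      _ = ENNReal.ofReal (∫ x, (θ * (‖ξ k x‖ ^ p + ‖ζ k x‖ ^ p)
            + C * breg p (ξ k x) (ζ k x)) ∂μ) := by
          rw [ofReal_integral_eq_lintegral_ofReal hI]
          filter_upwards with x
          have := breg_nonneg hp (ξ k x) (ζ k x)
          simp only [Pi.zero_apply]
          positivity
      _ ≤ _ := by
          apply ENNReal.ofReal_le_ofReal
          rw [integral_add (f := fun x => θ * (‖ξ k x‖ ^ p + ‖ζ k x‖ ^ p)) (((h1 k).add (h2 k)).const_mul θ) ((h3 k).const_mul C),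
            integral_const_mul, integral_const_mul, integral_add (h1 k) (h2 k)]
          have h6 : θ * (∫ x, ‖ξ k x‖ ^ p ∂μ + ∫ x, ‖ζ k x‖ ^ p ∂μ) ≤ θ * (2 * (B + 1)) := by
            have := hB1 k
            have := hB2 k
            gcongr
            linarith
          have h7 : θ * (2 * (B + 1)) = η / 2 := by
            simp only [θ]; field_simp; ring
          linarith
  rw [ENNReal.tendsto_nhds_zero]
  intro ε hε
  obtain ⟨η, hη, hle⟩ : ∃ η : ℝ, 0 < η ∧ ENNReal.ofReal η ≤ ε := by
    rcases eq_or_ne ε ⊤ with rfl | h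
    · exact ⟨1, one_pos, le_top⟩
    · exact ⟨ε.toReal, ENNReal.toReal_pos hε.ne' h, by rw [ENNReal.ofReal_toReal h]⟩
  filter_upwards [key η hη] with k hk using hk.trans hle

structure Apx (n : ℕ) (p : ℝ) (Ω : Set (EuclideanSpace ℝ (Fin n)))
    (v : ℕ → EuclideanSpace ℝ (Fin n) → ℝ) (r : ℕ → ℝ) : Prop where
  hv : ∀ k, C1c Ω (v k)
  h0 : ∀ k x, 0 ≤ v k x
  hn : Filter.Tendsto (fun k => ∫ x in Ω, v k x ^ p ∂(gaussianMeasure n)) Filter.atTop (𝓝 1)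
  hr : ∀ k, ∫ x in Ω, ‖gradient (v k) x‖ ^ p ∂(gaussianMeasure n) ≤ r k
  hl : Filter.Tendsto r Filter.atTop (𝓝 (lambdaPGamma n p Ω))

variable {v : ℕ → EuclideanSpace ℝ (Fin n) → ℝ} {r : ℕ → ℝ}

lemma Apx.stepA (H : Eig n p Ω u M) (A : Apx n p Ω v r) :
    Filter.Tendsto (fun k => ∫ x in Ω, breg p (gradient (v k) x) ((v k x / u x) • gradient u x)
      ∂(gaussianMeasure n)) Filter.atTop (𝓝 0) := by
  have h1 := A.hl.sub (A.hn.const_mul (lambdaPGamma n p Ω))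
  rw [mul_one, sub_self] at h1
  refine squeeze_zero (fun k => integral_nonneg fun x => breg_nonneg H.hp _ _) (fun k => ?_) h1
  rw [(H.picone (A.hv k) (A.h0 k)).2]
  linarith [A.hr k]

lemma Apx.bdd (H : Eig n p Ω u M) (A : Apx n p Ω v r) : ∃ B : ℝ, 0 ≤ B ∧ ∀ k,
    ∫ x in Ω, v k x ^ p ∂(gaussianMeasure n) ≤ B ∧
    ∫ x in Ω, ‖gradient (v k) x‖ ^ p ∂(gaussianMeasure n) ≤ B := by
  obtain ⟨B1, h1⟩ := A.hn.bddAbove_range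
  obtain ⟨B2, h2⟩ := A.hl.bddAbove_range
  have h1' : ∀ k, ∫ x in Ω, v k x ^ p ∂(gaussianMeasure n) ≤ B1 := fun k => h1 ⟨k, rfl⟩
  have h2' : ∀ k, r k ≤ B2 := fun k => h2 ⟨k, rfl⟩
  refine ⟨max B1 B2, ?_, fun k => ⟨(h1' k).trans (le_max_left _ _),
    ((A.hr k).trans (h2' k)).trans (le_max_right _ _)⟩⟩
  exact ((integral_nonneg fun x => Real.rpow_nonneg (A.h0 0 x) _).trans (h1' 0)).trans
    (le_max_left _ _)

lemma Eig.exists_pos (H : Eig n p Ω u M) {K : Set 𝔼} (hK : IsCompact K) (hKΩ : K ⊆ Ω) :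
    ∃ m : ℝ, 0 < m ∧ ∀ x ∈ K, m ≤ u x := by
  rcases K.eq_empty_or_nonempty with rfl | hne
  · exact ⟨1, one_pos, fun x hx => absurd hx (notMem_empty x)⟩
  · obtain ⟨x, hx, hmin⟩ := hK.exists_isMinOn hne (H.hu1.continuousOn.mono hKΩ)
    exact ⟨u x, H.hpos x (hKΩ hx), fun y hy => hmin hy⟩

lemma Eig.grad_div (H : Eig n p Ω u M) {w : 𝔼 → ℝ} (hw : ContDiff ℝ 1 w) {x : 𝔼} (hx : x ∈ Ω) :
    gradient w x - (w x / u x) • gradient u x = u x • gradient (fun y => w y / u y) x := by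
  have hu := H.hpos x hx
  have hdu : DifferentiableAt ℝ u x :=
    (H.hu1.differentiableOn one_ne_zero).differentiableAt (H.ho.mem_nhds hx)
  have hdw : DifferentiableAt ℝ w x := hw.differentiable one_ne_zero x
  have hq : DifferentiableAt ℝ (fun y => w y / u y) x := by
    simp only [div_eq_mul_inv]
    exact hdw.mul (hdu.inv hu.ne')
  have h1 : HasFDerivAt (fun y => (w y / u y) * u y) _ x := hq.hasFDerivAt.mul hdu.hasFDerivAt
  have h2 : (fun y => (w y / u y) * u y) =ᶠ[𝓝 x] w := by
    filter_upwards [H.ho.mem_nhds hx] with y hy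
    exact div_mul_cancel₀ _ (H.hpos y hy).ne'
  have h3 := (h1.congr_of_eventuallyEq h2.symm).fderiv
  have h4 : gradient w x = (w x / u x) • gradient u x + u x • gradient (fun y => w y / u y) x := by
    rw [gradient, h3, map_add, map_smul, map_smul]
    rfl
  rw [h4]; abel

lemma Apx.stepB (H : Eig n p Ω u M) (A : Apx n p Ω v r) {K : Set 𝔼} (hK : IsCompact K)
    (hKΩ : K ⊆ Ω) :
    Filter.Tendsto (fun k => ∫⁻ x in K, ‖gradient (fun y => v k y / u y) x‖ₑ ^ p)
      Filter.atTop (𝓝 0) := by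
  have hp := H.hp
  obtain ⟨m, hm, hmu⟩ := H.exists_pos hK hKΩ
  obtain ⟨B, hB0, hB⟩ := A.bdd H
  have hMpos := H.hM
  set μ := (gaussianMeasure n).restrict Ω with hμ
  have hle : (gaussianMeasure n).restrict K ≤ μ := Measure.restrict_mono hKΩ le_rfl
  have hKm := hK.measurableSet
  have hmem := ae_restrict_mem (μ := gaussianMeasure n) hKm
  -- pointwise bound
  have hpt : ∀ k, ∀ x ∈ K, ‖(v k x / u x) • gradient u x‖ ^ p ≤ (M / m) ^ p * v k x ^ p := by
    intro k x hx
    have h0 := A.h0 k x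
    have hu := H.hpos x (hKΩ hx)
    rw [← Real.mul_rpow (by positivity) h0, norm_smul, Real.norm_of_nonneg (by positivity)]
    have := hmu x hx
    have := H.hgM x (hKΩ hx)
    refine Real.rpow_le_rpow (by positivity) ?_ (by linarith)
    calc v k x / u x * ‖gradient u x‖ ≤ v k x / m * M := by gcongr
      _ = _ := by ring
  have iv : ∀ k, Integrable (fun x => v k x ^ p) μ := fun k =>
    (A.hv k).int_pow hp H.ho.measurableSet H.hb (A.h0 k)
  have ig : ∀ k, Integrable (fun x => ‖gradient (v k) x‖ ^ p) μ := fun k =>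
    (A.hv k).int_grad hp H.ho.measurableSet H.hb
  have hum : AEMeasurable u ((gaussianMeasure n).restrict K) := H.umeas.mono_measure hle
  have i2 : ∀ k, Integrable (fun x => ‖(v k x / u x) • gradient u x‖ ^ p)
      ((gaussianMeasure n).restrict K) := by
    intro k
    refine (((iv k).mono_measure hle).const_mul ((M / m) ^ p)).mono' ?_ ?_
    · exact (((((A.hv k).c1.continuous.measurable.aemeasurable.div hum).smul
        (measurable_gradient u).aemeasurable).norm).pow_const p).aestronglyMeasurable
    · filter_upwards [hmem] with x hx
      rw [Real.norm_of_nonneg (by positivity)]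
      exact hpt k x hx
  have h := breg_tendsto (μ := (gaussianMeasure n).restrict K) hp
    (fun k x => gradient (v k) x) (fun k x => (v k x / u x) • gradient u x)
    (max B ((M / m) ^ p * B))
    (fun k => (ig k).mono_measure hle) i2
    (fun k => ((integral_mono_measure hle (Filter.Eventually.of_forall fun x => by
      simp only [Pi.zero_apply]; positivity) (ig k)).trans (hB k).2).trans (le_max_left _ _))
    (fun k => by
      refine le_trans ?_ (le_max_right _ _)
      calc _ ≤ ∫ x in K, (M / m) ^ p * v k x ^ p ∂(gaussianMeasure n) :=
            setIntegral_mono_on (i2 k) (((iv k).mono_measure hle).const_mul _) hKm (hpt k)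
        _ ≤ ∫ x in Ω, (M / m) ^ p * v k x ^ p ∂(gaussianMeasure n) := by
            refine integral_mono_measure hle (Filter.Eventually.of_forall fun x => ?_)
              ((iv k).const_mul _)
            have := A.h0 k x
            simp only [Pi.zero_apply]; positivity
        _ ≤ _ := by
            rw [integral_const_mul]
            exact mul_le_mul_of_nonneg_left (hB k).1 (by positivity))
    (fun k => ((H.picone (A.hv k) (A.h0 k)).1).mono_measure hle)
    (squeeze_zero (fun k => integral_nonneg fun x => breg_nonneg hp _ _)
      (fun k => integral_mono_measure hle (Filter.Eventually.of_forall fun x =>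
        breg_nonneg hp _ _) (H.picone (A.hv k) (A.h0 k)).1) (A.stepA H))
  obtain ⟨a, b, ha, -, -, hab⟩ := gauss_compare K hKm hK.isBounded
  have hc : a * (ENNReal.ofReal m⁻¹) ^ p ≠ ⊤ := ENNReal.mul_ne_top ha
    (ENNReal.rpow_ne_top_of_nonneg (by linarith) ENNReal.ofReal_ne_top)
  have h' := ENNReal.Tendsto.const_mul (a := a * (ENNReal.ofReal m⁻¹) ^ p) h (Or.inr hc)
  rw [mul_zero] at h'
  refine tendsto_of_tendsto_of_tendsto_of_le_of_le tendsto_const_nhds h' (fun _ => zero_le) ?_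
  intro k
  calc ∫⁻ x in K, ‖gradient (fun y => v k y / u y) x‖ₑ ^ p
      ≤ ∫⁻ x, ‖gradient (fun y => v k y / u y) x‖ₑ ^ p
          ∂(a • (gaussianMeasure n).restrict K) := lintegral_mono' hab le_rfl
    _ = a * ∫⁻ x in K, ‖gradient (fun y => v k y / u y) x‖ₑ ^ p ∂(gaussianMeasure n) :=
        lintegral_smul_measure _ _
    _ ≤ a * ∫⁻ x in K, (ENNReal.ofReal m⁻¹) ^ p *
          ‖gradient (v k) x - (v k x / u x) • gradient u x‖ₑ ^ p ∂(gaussianMeasure n) := by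
        refine mul_le_mul_right ?_ a
        refine setLIntegral_mono' hKm fun x hx => ?_
        rw [← ENNReal.mul_rpow_of_nonneg _ _ (by linarith : (0:ℝ) ≤ p)]
        refine ENNReal.rpow_le_rpow ?_ (by linarith)
        rw [H.grad_div (A.hv k).c1 (hKΩ hx), enorm_smul, ← mul_assoc]
        refine le_mul_of_one_le_left zero_le ?_
        have hu := H.hpos x (hKΩ hx)
        rw [Real.enorm_eq_ofReal hu.le, ← ENNReal.ofReal_mul (by positivity),
          ENNReal.one_le_ofReal]
        rw [inv_mul_eq_div, one_le_div hm]
        exact hmu x hx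
    _ = _ := by
        rw [lintegral_const_mul' _ _ (ENNReal.rpow_ne_top_of_nonneg (by linarith)
          ENNReal.ofReal_ne_top), ← mul_assoc]
end SeqSec

section StepC
variable {n : ℕ}
local notation "𝔼" => EuclideanSpace ℝ (Fin n)
variable {p M : ℝ} {Ω : Set (EuclideanSpace ℝ (Fin n))} {u : EuclideanSpace ℝ (Fin n) → ℝ}
variable {v : ℕ → EuclideanSpace ℝ (Fin n) → ℝ} {r : ℕ → ℝ}

lemma strip_gauss (hp : 1 < p) (hΩo : IsOpen Ω) (hΩc : Convex ℝ Ω)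
    (hΩb : IsBounded Ω) (hne : Ω.Nonempty) (s : ENNReal) (hs : s ≠ 0) (hs' : s ≠ ⊤) :
    ∃ K : Set 𝔼, IsCompact K ∧ K ⊆ Ω ∧ Convex ℝ K ∧ (interior K).Nonempty ∧
      ∀ w : 𝔼 → ℝ, C1c Ω w → ∫⁻ x in Ω \ K, ‖w x‖ₑ ^ p ∂(gaussianMeasure n) ≤
        s * ∫⁻ x in Ω, ‖gradient w x‖ₑ ^ p ∂(gaussianMeasure n) := by
  obtain ⟨a, b, ha, hb, hab, hba⟩ := gauss_compare Ω hΩo.measurableSet hΩb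
  have hd0 : a * b + 1 ≠ 0 := by simp
  have hdt : a * b + 1 ≠ ⊤ := ENNReal.add_ne_top.2 ⟨ENNReal.mul_ne_top ha hb, ENNReal.one_ne_top⟩
  obtain ⟨K, hK, hKΩ, hKc, hKi, h⟩ := strip hp Ω hΩo hΩc hΩb hne (s / (a * b + 1))
    (ENNReal.div_pos hs hdt)
  refine ⟨K, hK, hKΩ, hKc, hKi, fun w hw => ?_⟩
  have hab' : (gaussianMeasure n).restrict (Ω \ K) ≤ b • volume.restrict (Ω \ K) := by
    have h1 := Measure.restrict_mono_measure hab (Ω \ K)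
    rw [Measure.restrict_smul, Measure.restrict_restrict (hΩo.measurableSet.diff hK.measurableSet),
      Measure.restrict_restrict (hΩo.measurableSet.diff hK.measurableSet),
      inter_eq_left.2 diff_subset] at h1
    exact h1
  calc ∫⁻ x in Ω \ K, ‖w x‖ₑ ^ p ∂(gaussianMeasure n)
      ≤ ∫⁻ x, ‖w x‖ₑ ^ p ∂(b • volume.restrict (Ω \ K)) := lintegral_mono' hab' le_rfl
    _ = b * ∫⁻ x in Ω \ K, ‖w x‖ₑ ^ p := lintegral_smul_measure _ _
    _ ≤ b * (s / (a * b + 1) * ∫⁻ x in Ω, ‖gradient w x‖ₑ ^ p) := by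
        gcongr; exact h w hw.c1 hw.ts
    _ ≤ b * (s / (a * b + 1) * ∫⁻ x, ‖gradient w x‖ₑ ^ p ∂(a • (gaussianMeasure n).restrict Ω)) := by
        gcongr
    _ = (s / (a * b + 1) * (a * b)) * ∫⁻ x in Ω, ‖gradient w x‖ₑ ^ p ∂(gaussianMeasure n) := by
        rw [lintegral_smul_measure, smul_eq_mul]; ring
    _ ≤ _ := by
        gcongr
        calc s / (a * b + 1) * (a * b) ≤ s / (a * b + 1) * (a * b + 1) := by
              gcongr; exact le_self_add
          _ = s := ENNReal.div_mul_cancel hd0 hdt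

lemma int_lint {F : Type*} [NormedAddCommGroup F] {μ : Measure 𝔼} (hp : 1 < p) {g : 𝔼 → F}
    (hg : Integrable (fun x => ‖g x‖ ^ p) μ) :
    ∫⁻ x, ‖g x‖ₑ ^ p ∂μ = ENNReal.ofReal (∫ x, ‖g x‖ ^ p ∂μ) := by
  rw [ofReal_integral_eq_lintegral_ofReal hg (Filter.Eventually.of_forall fun x => by
    simp only [Pi.zero_apply]; positivity)]
  refine lintegral_congr fun x => ?_
  rw [enorm_rpow_ofReal _ (by linarith)]

lemma Eig.strip_u (H : Eig n p Ω u M) (B t : ENNReal) (hB : B ≠ ⊤) (ht : t ≠ 0) (ht' : t ≠ ⊤) :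
    ∃ K : Set 𝔼, IsCompact K ∧ K ⊆ Ω ∧ Convex ℝ K ∧ (interior K).Nonempty ∧
      (∀ w : 𝔼 → ℝ, C1c Ω w → ∫⁻ x in Ω, ‖gradient w x‖ₑ ^ p ∂(gaussianMeasure n) ≤ B →
        ∫⁻ x in Ω \ K, ‖w x‖ₑ ^ p ∂(gaussianMeasure n) ≤ t) ∧
      ∫⁻ x in Ω \ K, ‖u x‖ₑ ^ p ∂(gaussianMeasure n) ≤ t := by
  have hp := H.hp
  obtain ⟨w, C, hw⟩ := trunc Ω H.ho H.hb u H.hu0 H.hu1 H.nonneg_cl H.hub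
  have hgu : ∫⁻ x in Ω, ‖gradient u x‖ₑ ^ p ∂(gaussianMeasure n) ≠ ⊤ := by
    rw [int_lint hp H.int_gradu]; exact ENNReal.ofReal_ne_top
  set D : ENNReal := ENNReal.ofReal |C| ^ p *
    ∫⁻ x in Ω, ‖gradient u x‖ₑ ^ p ∂(gaussianMeasure n) with hD
  have hDt : D ≠ ⊤ := ENNReal.mul_ne_top (ENNReal.rpow_ne_top_of_nonneg (by linarith)
    ENNReal.ofReal_ne_top) hgu
  set E := max B D + 1
  have hE0 : E ≠ 0 := by simp [E]
  have hEt : E ≠ ⊤ := by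
    have : max B D ≠ ⊤ := (max_lt hB.lt_top hDt.lt_top).ne
    exact ENNReal.add_ne_top.2 ⟨this, ENNReal.one_ne_top⟩
  obtain ⟨K, hK, hKΩ, hKc, hKi, h⟩ := strip_gauss hp H.ho H.hc H.hb H.hne (t / E)
    (ENNReal.div_pos ht hEt).ne' (ENNReal.div_ne_top ht' hE0)
  have h' : ∀ w : 𝔼 → ℝ, C1c Ω w → ∫⁻ x in Ω, ‖gradient w x‖ₑ ^ p ∂(gaussianMeasure n) ≤ max B D →
        ∫⁻ x in Ω \ K, ‖w x‖ₑ ^ p ∂(gaussianMeasure n) ≤ t := by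
    intro w hw hwB
    refine (h w hw).trans ?_
    calc _ ≤ t / E * E := by gcongr; exact hwB.trans le_self_add
      _ = t := ENNReal.div_mul_cancel hE0 hEt
  refine ⟨K, hK, hKΩ, hKc, hKi, fun w hw hwB => h' w hw (hwB.trans (le_max_left _ _)), ?_⟩
  have hw2 : ∀ k, ∫⁻ x in Ω \ K, ‖w k x‖ₑ ^ p ∂(gaussianMeasure n) ≤ t := by
    intro k
    refine h' _ ⟨(hw k).1.1, (hw k).1.2.1, (hw k).1.2.2.1⟩ (le_trans ?_ (le_max_right _ _))
    rw [hD, ← lintegral_const_mul' _ _ (ENNReal.rpow_ne_top_of_nonneg (by linarith)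
      ENNReal.ofReal_ne_top)]
    refine setLIntegral_mono' H.ho.measurableSet fun x hx => ?_
    rw [← ENNReal.mul_rpow_of_nonneg _ _ (by linarith : (0:ℝ) ≤ p)]
    refine ENNReal.rpow_le_rpow ?_ (by linarith)
    rw [← ofReal_norm_eq_enorm, ← ofReal_norm_eq_enorm, ← ENNReal.ofReal_mul (abs_nonneg _)]
    refine ENNReal.ofReal_le_ofReal (((hw k).1.2.2.2.2 x hx).2.trans ?_)
    have := le_abs_self C
    gcongr
  have hm := H.ho.measurableSet.diff hK.measurableSet
  calc ∫⁻ x in Ω \ K, ‖u x‖ₑ ^ p ∂(gaussianMeasure n)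
      = ∫⁻ x in Ω \ K, Filter.liminf (fun k => ‖w k x‖ₑ ^ p) Filter.atTop
          ∂(gaussianMeasure n) := by
        refine setLIntegral_congr_fun hm fun x hx => ?_
        refine (Filter.Tendsto.liminf_eq ?_).symm
        refine tendsto_const_nhds.congr' ?_
        filter_upwards [(hw 0).2 x hx.1] with k hk
        rw [hk.1]
    _ ≤ Filter.liminf (fun k => ∫⁻ x in Ω \ K, ‖w k x‖ₑ ^ p ∂(gaussianMeasure n))
          Filter.atTop := by
        refine lintegral_liminf_le fun k => ?_
        exact ((hw k).1.1.continuous.measurable.enorm).pow_const p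
    _ ≤ t := by
        refine Filter.liminf_le_of_le ?_ ?_
        · isBoundedDefault
        · intro b hb
          obtain ⟨k, hk⟩ := hb.exists
          exact hk.trans (hw2 k)

lemma Apx.gB (H : Eig n p Ω u M) (A : Apx n p Ω v r) : ∃ B : ENNReal, B ≠ ⊤ ∧ ∀ k,
    ∫⁻ x in Ω, ‖gradient (v k) x‖ₑ ^ p ∂(gaussianMeasure n) ≤ B := by
  obtain ⟨B, -, hB⟩ := A.bdd H
  refine ⟨ENNReal.ofReal B, ENNReal.ofReal_ne_top, fun k => ?_⟩
  rw [int_lint H.hp ((A.hv k).int_grad H.hp H.ho.measurableSet H.hb)]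
  exact ENNReal.ofReal_le_ofReal (hB k).2

lemma Apx.stepC1 (H : Eig n p Ω u M) (A : Apx n p Ω v r) {K : Set 𝔼} (hK : IsCompact K)
    (hKΩ : K ⊆ Ω) (hKc : Convex ℝ K) (hKi : (interior K).Nonempty) (t : ENNReal) (ht : t ≠ 0)
    (ht' : t ≠ ⊤) :
    ∀ᶠ k in Filter.atTop, ∃ c : ℝ, 0 ≤ c ∧
      ∫⁻ x in K, ‖v k x - c * u x‖ₑ ^ p ∂(gaussianMeasure n) ≤ t := by
  have hp := H.hp
  have hKm := hK.measurableSet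
  obtain ⟨a, b, -, hb, hab, -⟩ := gauss_compare K hKm hK.isBounded
  set E : ENNReal := b * ENNReal.ofReal M ^ p + 1
  have hMt : ENNReal.ofReal M ^ p ≠ ⊤ :=
    ENNReal.rpow_ne_top_of_nonneg (by linarith) ENNReal.ofReal_ne_top
  have hE0 : E ≠ 0 := by simp [E]
  have hEt : E ≠ ⊤ := ENNReal.add_ne_top.2 ⟨ENNReal.mul_ne_top hb hMt, ENNReal.one_ne_top⟩
  set δ := t / E
  have hδ : 0 < δ := ENNReal.div_pos ht hEt
  obtain ⟨R, hR⟩ := hK.isBounded.subset_closedBall 0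
  have hdiam : ∀ x ∈ K, ∀ y ∈ K, ‖y - x‖ ≤ 2 * R := by
    intro x hx y hy
    have h1 := mem_closedBall_zero_iff.1 (hR hx)
    have h2 := mem_closedBall_zero_iff.1 (hR hy)
    linarith [norm_sub_le y x]
  have hvol : 0 < volume K := (isOpen_interior.measure_pos _ hKi).trans_le
    (measure_mono interior_subset)
  have hvolt : volume K ≠ ⊤ := hK.measure_lt_top.ne
  set P : ENNReal := ENNReal.ofReal (2 * R) ^ p * volume (closedBall (0:𝔼) (2 * R))
  have hP : P ≠ ⊤ := ENNReal.mul_ne_top (ENNReal.rpow_ne_top_of_nonneg (by linarith)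
    ENNReal.ofReal_ne_top) (isCompact_closedBall _ _).measure_lt_top.ne
  have hB := ENNReal.Tendsto.const_mul (a := P) (A.stepB H hK hKΩ) (Or.inr hP)
  rw [mul_zero] at hB
  have hpos : 0 < δ * volume K := ENNReal.mul_pos hδ.ne' hvol.ne'
  filter_upwards [hB.eventually (gt_mem_nhds hpos)] with k hk
  have hfC : ContDiffOn ℝ 1 (fun y => v k y / u y) Ω :=
    (A.hv k).c1.contDiffOn.div H.hu1 fun x hx => (H.hpos x hx).ne'
  have hpo := poincare hp (fun y => v k y / u y) Ω H.ho hfC K hKm hKΩ hKc (2 * R) hdiam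
  obtain ⟨x, hx, hxle⟩ : ∃ x ∈ K, ∫⁻ y in K, ‖v k y / u y - v k x / u x‖ₑ ^ p ≤ δ := by
    by_contra! hcon
    have : δ * volume K ≤ ∫⁻ x in K, ∫⁻ y in K, ‖v k y / u y - v k x / u x‖ₑ ^ p := by
      rw [← setLIntegral_const]
      exact setLIntegral_mono' hKm fun x hx => (hcon x hx).le
    exact absurd (this.trans hpo) (not_le.2 hk)
  refine ⟨v k x / u x, div_nonneg (A.h0 k x) (H.hpos x (hKΩ hx)).le, ?_⟩
  calc ∫⁻ y in K, ‖v k y - v k x / u x * u y‖ₑ ^ p ∂(gaussianMeasure n)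
      ≤ ∫⁻ y in K, ENNReal.ofReal M ^ p * ‖v k y / u y - v k x / u x‖ₑ ^ p
          ∂(gaussianMeasure n) := by
        refine setLIntegral_mono' hKm fun y hy => ?_
        rw [← ENNReal.mul_rpow_of_nonneg _ _ (by linarith : (0:ℝ) ≤ p)]
        refine ENNReal.rpow_le_rpow ?_ (by linarith)
        have hu := H.hpos y (hKΩ hy)
        have : v k y - v k x / u x * u y = u y * (v k y / u y - v k x / u x) := by
          field_simp
        rw [this, enorm_mul, Real.enorm_eq_ofReal hu.le]
        gcongr
        exact H.huM y (hKΩ hy)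
    _ ≤ ∫⁻ y, ENNReal.ofReal M ^ p * ‖v k y / u y - v k x / u x‖ₑ ^ p
          ∂(b • volume.restrict K) := lintegral_mono' hab le_rfl
    _ = b * (ENNReal.ofReal M ^ p * ∫⁻ y in K, ‖v k y / u y - v k x / u x‖ₑ ^ p) := by
        rw [lintegral_smul_measure, lintegral_const_mul' _ _ hMt, smul_eq_mul]
    _ ≤ b * (ENNReal.ofReal M ^ p * δ) := by gcongr
    _ = δ * (b * ENNReal.ofReal M ^ p) := by ring
    _ ≤ δ * E := by gcongr; exact le_self_add
    _ = t := ENNReal.div_mul_cancel hE0 hEt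
end StepC

section StepD
variable {n : ℕ}
local notation "𝔼" => EuclideanSpace ℝ (Fin n)
variable {p M : ℝ} {Ω : Set (EuclideanSpace ℝ (Fin n))} {u : EuclideanSpace ℝ (Fin n) → ℝ}
variable {v : ℕ → EuclideanSpace ℝ (Fin n) → ℝ} {r : ℕ → ℝ}

lemma elp_sub_le {f g : 𝔼 → ℝ} {μ : Measure 𝔼} (hf : AEStronglyMeasurable f μ)
    (hg : AEStronglyMeasurable g μ) (hp : 1 ≤ p) :
    eLpNorm' (f - g) p μ ≤ eLpNorm' f p μ + eLpNorm' g p μ := by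
  rw [sub_eq_add_neg, ← eLpNorm'_neg g]
  exact eLpNorm'_add_le hf hg.neg hp

lemma Eig.int_pow_u (H : Eig n p Ω u M) :
    Integrable (fun x => u x ^ p) ((gaussianMeasure n).restrict Ω) := by
  by_contra h
  have := H.hnorm
  rw [integral_undef h] at this
  exact zero_ne_one this

lemma Eig.norm_u (H : Eig n p Ω u M) : eLpNorm' u p ((gaussianMeasure n).restrict Ω) = 1 := by
  have hae : (fun x => ‖u x‖ ^ p) =ᵐ[(gaussianMeasure n).restrict Ω] fun x => u x ^ p := by
    filter_upwards [ae_restrict_mem (μ := gaussianMeasure n) H.ho.measurableSet] with x hx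
    rw [Real.norm_of_nonneg (H.hpos x hx).le]
  rw [eLpNorm', int_lint H.hp ((integrable_congr hae).2 H.int_pow_u), integral_congr_ae hae,
    H.hnorm]
  simp

lemma Apx.norm_v (H : Eig n p Ω u M) (A : Apx n p Ω v r) :
    Filter.Tendsto (fun k => eLpNorm' (v k) p ((gaussianMeasure n).restrict Ω)) Filter.atTop
      (𝓝 1) := by
  have e : ∀ k, eLpNorm' (v k) p ((gaussianMeasure n).restrict Ω) =
      ENNReal.ofReal (∫ x in Ω, v k x ^ p ∂(gaussianMeasure n)) ^ (1 / p) := by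
    intro k
    have hh : (fun x => ‖v k x‖ ^ p) = fun x => v k x ^ p := by
      ext x; rw [Real.norm_of_nonneg (A.h0 k x)]
    have hi := (A.hv k).int_pow H.hp H.ho.measurableSet H.hb (A.h0 k)
    rw [eLpNorm', int_lint H.hp (by rw [hh]; exact hi), hh]
  simp_rw [e]
  have := (ENNReal.tendsto_ofReal A.hn).ennrpow_const (1 / p)
  simpa using this

lemma Apx.stepC2 (H : Eig n p Ω u M) (A : Apx n p Ω v r) (τ : ℝ) (hτ : 0 < τ) :
    ∀ᶠ k in Filter.atTop, ∃ c : ℝ, 0 ≤ c ∧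
      eLpNorm' (v k - c • u) p ((gaussianMeasure n).restrict Ω) ≤ ENNReal.ofReal (τ * (2 + c)) := by
  have hp := H.hp
  have hp0 : 0 < p := by linarith
  obtain ⟨B, hB, hgB⟩ := A.gB H
  set t : ENNReal := ENNReal.ofReal τ ^ p
  have ht' : t ≠ ⊤ := ENNReal.rpow_ne_top_of_nonneg hp0.le ENNReal.ofReal_ne_top
  have ht : t ≠ 0 := by
    have := ENNReal.rpow_pos (p := p) (ENNReal.ofReal_pos.2 hτ) ENNReal.ofReal_ne_top
    exact this.ne'
  have htp : t ^ (1 / p) = ENNReal.ofReal τ := by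
    rw [← ENNReal.rpow_mul, mul_one_div_cancel hp0.ne', ENNReal.rpow_one]
  obtain ⟨K, hK, hKΩ, hKc, hKi, hs, hsu⟩ := H.strip_u B t hB ht ht'
  filter_upwards [A.stepC1 H hK hKΩ hKc hKi t ht ht'] with k hk
  obtain ⟨c, hc, hck⟩ := hk
  refine ⟨c, hc, ?_⟩
  have hle : (gaussianMeasure n).restrict (Ω \ K) ≤ (gaussianMeasure n).restrict Ω :=
    Measure.restrict_mono diff_subset le_rfl
  have hum : AEStronglyMeasurable u ((gaussianMeasure n).restrict (Ω \ K)) :=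
    (H.umeas.mono_measure hle).aestronglyMeasurable
  have hvm : AEStronglyMeasurable (v k) ((gaussianMeasure n).restrict (Ω \ K)) :=
    (A.hv k).c1.continuous.aestronglyMeasurable
  have hb1 : eLpNorm' (v k - c • u) p ((gaussianMeasure n).restrict K) ≤ ENNReal.ofReal τ := by
    rw [eLpNorm', ← htp]
    exact ENNReal.rpow_le_rpow hck (by positivity)
  have hb2 : eLpNorm' (v k - c • u) p ((gaussianMeasure n).restrict (Ω \ K)) ≤
      ENNReal.ofReal τ + ENNReal.ofReal c * ENNReal.ofReal τ := by
    refine (elp_sub_le hvm (hum.const_smul c) hp.le).trans ?_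
    rw [eLpNorm'_const_smul _ hp0, Real.enorm_eq_ofReal hc]
    gcongr
    · rw [eLpNorm', ← htp]
      exact ENNReal.rpow_le_rpow (hs _ (A.hv k) (hgB k)) (by positivity)
    · rw [eLpNorm', ← htp]
      exact ENNReal.rpow_le_rpow hsu (by positivity)
  have hsplit : eLpNorm' (v k - c • u) p ((gaussianMeasure n).restrict Ω) ≤
      eLpNorm' (v k - c • u) p ((gaussianMeasure n).restrict K) +
      eLpNorm' (v k - c • u) p ((gaussianMeasure n).restrict (Ω \ K)) := by
    rw [eLpNorm', eLpNorm', eLpNorm']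
    refine le_trans ?_ (ENNReal.rpow_add_le_add_rpow _ _ (by positivity)
      (by rw [div_le_one hp0]; exact hp.le))
    refine ENNReal.rpow_le_rpow (le_of_eq ?_) (by positivity)
    rw [← lintegral_inter_add_diff _ Ω hK.measurableSet, inter_eq_right.2 hKΩ]
  refine hsplit.trans ((add_le_add hb1 hb2).trans (le_of_eq ?_))
  rw [← ENNReal.ofReal_mul hc, ← ENNReal.ofReal_add hτ.le (by positivity),
    ← ENNReal.ofReal_add hτ.le (by positivity)]
  congr 1; ring

lemma Apx.stepC (H : Eig n p Ω u M) (A : Apx n p Ω v r) :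
    Filter.Tendsto (fun k => eLpNorm' (v k - u) p ((gaussianMeasure n).restrict Ω)) Filter.atTop
      (𝓝 0) := by
  have hp := H.hp
  have hp0 : 0 < p := by linarith
  set μ := (gaussianMeasure n).restrict Ω
  have key : ∀ τ : ℝ, 0 < τ → τ ≤ 1 / 2 → ∀ᶠ k in Filter.atTop,
      eLpNorm' (v k - u) p μ ≤ ENNReal.ofReal (15 * τ) := by
    intro τ hτ hτ2
    have e1 := (A.norm_v H).eventually (gt_mem_nhds (show (1:ENNReal) < ENNReal.ofReal (1 + τ) by
      rw [ENNReal.one_lt_ofReal]; linarith))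
    have e2 := (A.norm_v H).eventually (lt_mem_nhds (show ENNReal.ofReal (1 - τ) < (1:ENNReal) by
      rw [ENNReal.ofReal_lt_one]; linarith))
    filter_upwards [e1, e2, A.stepC2 H τ hτ] with k h1 h2 h3
    obtain ⟨c, hc, h3⟩ := h3
    have hum : AEStronglyMeasurable u μ := H.umeas.aestronglyMeasurable
    have hvm : AEStronglyMeasurable (v k) μ := (A.hv k).c1.continuous.aestronglyMeasurable
    have hcu : eLpNorm' (c • u) p μ = ENNReal.ofReal c := by
      rw [eLpNorm'_const_smul _ hp0, H.norm_u, mul_one, Real.enorm_eq_ofReal hc]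
    have hcum := hum.const_smul c
    have t1 : ENNReal.ofReal c ≤ ENNReal.ofReal (1 + τ) + ENNReal.ofReal (τ * (2 + c)) := by
      rw [← hcu]
      calc eLpNorm' (c • u) p μ = eLpNorm' (v k - (v k - c • u)) p μ := by
            rw [sub_sub_cancel]
        _ ≤ _ := elp_sub_le hvm (hvm.sub hcum) hp.le
        _ ≤ _ := add_le_add h1.le h3
    have t2 : ENNReal.ofReal (1 - τ) ≤ ENNReal.ofReal c + ENNReal.ofReal (τ * (2 + c)) := by
      refine h2.le.trans ?_
      calc eLpNorm' (v k) p μ = eLpNorm' (c • u + (v k - c • u)) p μ := by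
            rw [add_sub_cancel]
        _ ≤ _ := eLpNorm'_add_le hcum (hvm.sub hcum) hp.le
        _ ≤ _ := add_le_add hcu.le h3
    rw [← ENNReal.ofReal_add (by positivity) (by positivity),
      ENNReal.ofReal_le_ofReal_iff (by positivity)] at t1 t2
    have hc5 : c ≤ 5 := by nlinarith
    have hc8 : |c - 1| ≤ 8 * τ := by
      rw [abs_le]; constructor <;> nlinarith
    calc eLpNorm' (v k - u) p μ = eLpNorm' ((v k - c • u) + (c - 1) • u) p μ := by
          congr 1; rw [sub_smul, one_smul]; abel
      _ ≤ _ := eLpNorm'_add_le (hvm.sub hcum) (hum.const_smul _) hp.le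
      _ ≤ ENNReal.ofReal (τ * (2 + c)) + ENNReal.ofReal |c - 1| := by
          refine add_le_add h3 (le_of_eq ?_)
          rw [eLpNorm'_const_smul _ hp0, H.norm_u, mul_one, ← ofReal_norm_eq_enorm,
            Real.norm_eq_abs]
      _ ≤ _ := by
          rw [← ENNReal.ofReal_add (by positivity) (by positivity)]
          apply ENNReal.ofReal_le_ofReal
          nlinarith
  rw [ENNReal.tendsto_nhds_zero]
  intro ε hε
  obtain ⟨η, hη, hη2, hle⟩ : ∃ η : ℝ, 0 < η ∧ η ≤ 1 / 2 ∧ ENNReal.ofReal (15 * η) ≤ ε := by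
    rcases eq_or_ne ε ⊤ with rfl | h
    · exact ⟨1 / 2, by norm_num, le_rfl, le_top⟩
    · have hpos := ENNReal.toReal_pos hε.ne' h
      refine ⟨min (1 / 2) (ε.toReal / 15), by positivity, min_le_left _ _, ?_⟩
      refine ENNReal.ofReal_le_of_le_toReal ?_
      have := min_le_right (1 / 2) (ε.toReal / 15)
      linarith
  filter_upwards [key η hη hη2] with k hk using hk.trans hle

lemma Apx.stepD1 (H : Eig n p Ω u M) (A : Apx n p Ω v r) :
    Filter.Tendsto (fun k => ∫ x in Ω, u x ^ (p - 1) * v k x ∂(gaussianMeasure n)) Filter.atTop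
      (𝓝 1) := by
  have hp := H.hp
  have hp0 : 0 < p := by linarith
  have hfin := gauss_finite H.ho.measurableSet H.hb
  have hmem := ae_restrict_mem (μ := gaussianMeasure n) H.ho.measurableSet
  have hum : AEStronglyMeasurable u ((gaussianMeasure n).restrict Ω) := H.umeas.aestronglyMeasurable
  have hvm : ∀ k, AEStronglyMeasurable (v k) ((gaussianMeasure n).restrict Ω) :=
    fun k => (A.hv k).c1.continuous.aestronglyMeasurable
  set μ := (gaussianMeasure n).restrict Ω
  have e2 : ∫ x, u x ^ (p - 1) * u x ∂μ = 1 := by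
    refine Eq.trans ?_ H.hnorm
    refine integral_congr_ae ?_
    filter_upwards [hmem] with x hx
    rw [← Real.rpow_add_one (H.hpos x hx).ne']; congr 1; ring
  suffices hS : Filter.Tendsto (fun k => ∫ x in Ω, u x ^ (p - 1) * v k x ∂(gaussianMeasure n))
      Filter.atTop (𝓝 (∫ x, u x ^ (p - 1) * u x ∂μ)) by rwa [e2] at hS
  have iu : Integrable (fun x => u x ^ (p - 1) * u x) μ := by
    by_contra h
    rw [integral_undef h] at e2
    exact zero_ne_one e2
  have iv : ∀ k, Integrable (fun x => u x ^ (p - 1) * v k x) μ := by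
    intro k
    obtain ⟨C, hC⟩ := (A.hv k).bdd
    refine Integrable.of_bound (((H.umeas.pow_const _).mul
      (hvm k).aemeasurable).aestronglyMeasurable) (M ^ (p - 1) * C) ?_
    filter_upwards [hmem] with x hx
    rw [norm_mul]
    have := H.hM
    exact mul_le_mul (H.upow_le hx) (hC x).1 (norm_nonneg _) (by positivity)
  refine tendsto_integral_of_L1 _ iu.aestronglyMeasurable (Filter.Eventually.of_forall iv) ?_
  set D : ENNReal := ENNReal.ofReal (M ^ (p - 1)) * μ univ ^ (1 / 1 - 1 / p)
  have hD : D ≠ ⊤ := ENNReal.mul_ne_top ENNReal.ofReal_ne_top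
    (ENNReal.rpow_ne_top_of_nonneg (by rw [sub_nonneg, div_le_div_iff₀ hp0 one_pos]; linarith)
      (measure_ne_top _ _))
  have hl := ENNReal.Tendsto.const_mul (a := D) (A.stepC H) (Or.inr hD)
  rw [mul_zero] at hl
  refine tendsto_of_tendsto_of_tendsto_of_le_of_le tendsto_const_nhds hl (fun _ => zero_le) ?_
  intro k
  calc ∫⁻ x, ‖u x ^ (p - 1) * v k x - u x ^ (p - 1) * u x‖ₑ ∂μ
      ≤ ∫⁻ x, ENNReal.ofReal (M ^ (p - 1)) * ‖(v k - u) x‖ₑ ∂μ := by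
        refine lintegral_mono_ae ?_
        filter_upwards [hmem] with x hx
        rw [← mul_sub, enorm_mul, ← ofReal_norm_eq_enorm]
        gcongr
        · exact H.upow_le hx
        · rfl
    _ = ENNReal.ofReal (M ^ (p - 1)) * eLpNorm' (v k - u) 1 μ := by
        rw [lintegral_const_mul' _ _ ENNReal.ofReal_ne_top, eLpNorm']
        simp
    _ ≤ ENNReal.ofReal (M ^ (p - 1)) * (eLpNorm' (v k - u) p μ * μ univ ^ (1 / 1 - 1 / p)) := by
        gcongr
        exact eLpNorm'_le_eLpNorm'_mul_rpow_measure_univ one_pos hp.le ((hvm k).sub hum)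
    _ = _ := by simp only [D]; ring

lemma Apx.stepD (H : Eig n p Ω u M) (A : Apx n p Ω v r) :
    Filter.Tendsto (fun k => ∫⁻ x in Ω, ‖gradient (v k) x - gradient u x‖ₑ ^ p
      ∂(gaussianMeasure n)) Filter.atTop (𝓝 0) := by
  have hp := H.hp
  obtain ⟨B, hB0, hB⟩ := A.bdd H
  refine breg_tendsto hp (fun k => gradient (v k)) (fun _ => gradient u)
    (max B (lambdaPGamma n p Ω)) (fun k => (A.hv k).int_grad hp H.ho.measurableSet H.hb)
    (fun _ => H.int_gradu) (fun k => (hB k).2.trans (le_max_left _ _))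
    (fun _ => H.energy.le.trans (le_max_right _ _)) (fun k => (H.breg_u (A.hv k)).1) ?_
  have h1 := (A.hl.add_const ((p - 1) * lambdaPGamma n p Ω)).sub
    (((A.stepD1 H).const_mul (lambdaPGamma n p Ω)).const_mul p)
  rw [show lambdaPGamma n p Ω + (p - 1) * lambdaPGamma n p Ω - p * (lambdaPGamma n p Ω * 1) = 0 by
    ring] at h1
  refine squeeze_zero (fun k => integral_nonneg fun x => breg_nonneg hp _ _) (fun k => ?_) h1
  rw [(H.breg_u (A.hv k)).2]
  linarith [A.hr k]
end StepD

section Fin8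
variable {n : ℕ}
local notation "𝔼" => EuclideanSpace ℝ (Fin n)
variable {p M : ℝ} {Ω : Set (EuclideanSpace ℝ (Fin n))} {u : EuclideanSpace ℝ (Fin n) → ℝ}

lemma IsTestFun.c1c {w : 𝔼 → ℝ} (h : IsTestFun n Ω w) : C1c Ω w :=
  ⟨h.1.of_le (by exact_mod_cast le_top), h.2.1, h.2.2⟩

lemma mk_eig (hp : 1 < p)
    (hΩo : IsOpen Ω) (hΩb : IsBounded Ω) (hΩconv : Convex ℝ Ω)
    (hu1 : ContDiffOn ℝ 1 u (closure Ω))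
    (hupos : ∀ x ∈ Ω, 0 < u x)
    (hub : ∀ x ∈ frontier Ω, u x = 0)
    (hnorm : (∫ x in Ω, u x ^ p ∂(gaussianMeasure n)) = 1)
    (heig : ∀ φ : EuclideanSpace ℝ (Fin n) → ℝ, IsTestFun n Ω φ →
      ∫ x in Ω, ‖gradient u x‖ ^ (p - 2) * ⟪gradient u x, gradient φ x⟫ ∂(gaussianMeasure n)
        = lambdaPGamma n p Ω * ∫ x in Ω, u x ^ (p - 1) * φ x ∂(gaussianMeasure n)) :
    ∃ M, Eig n p Ω u M := by
  have hne : Ω.Nonempty := by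
    by_contra h
    rw [not_nonempty_iff_eq_empty] at h
    rw [h] at hnorm
    simp at hnorm
  have hcomp : IsCompact (closure Ω) := hΩb.isCompact_closure
  have hud : UniqueDiffOn ℝ (closure Ω) := uniqueDiffOn_convex hΩconv.closure
    (hne.mono (hΩo.subset_interior_iff.2 subset_closure))
  obtain ⟨M1, h1⟩ := hcomp.exists_bound_of_continuousOn hu1.continuousOn
  obtain ⟨M2, h2⟩ := hcomp.exists_bound_of_continuousOn
    (hu1.continuousOn_fderivWithin hud le_rfl)
  refine ⟨max 1 (max M1 M2), hp, hΩo, hΩb, hΩconv, hne, hu1.continuousOn, hu1.mono subset_closure,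
    hupos, hub, by positivity, fun x hx => ?_, fun x hx => ?_, hnorm, heig⟩
  · exact ((le_abs_self _).trans (h1 x (subset_closure hx))).trans
      ((le_max_left _ _).trans (le_max_right _ _))
  · rw [gradient, LinearIsometryEquiv.norm_map]
    have := h2 x (subset_closure hx)
    rw [fderivWithin_of_mem_nhds (Filter.mem_of_superset (hΩo.mem_nhds hx) subset_closure)] at this
    exact this.trans ((le_max_right _ _).trans (le_max_right _ _))

lemma gradient_const_mul' {w : 𝔼 → ℝ} (hw : ContDiff ℝ 1 w) (c : ℝ) (x : 𝔼) :
    gradient (fun y => c * w y) x = c • gradient w x := by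
  have h : HasFDerivAt (fun y => c * w y) (c • fderiv ℝ w x) x :=
    ((hw.differentiable one_ne_zero x).hasFDerivAt).const_mul c
  rw [gradient, h.fderiv, map_smul]
  rfl

lemma pow_pos_int (hp : 1 < p) (hΩo : IsOpen Ω) (hΩb : IsBounded Ω) {w : 𝔼 → ℝ}
    (hw : C1c Ω w) (h0 : w ≠ 0) : 0 < ∫ x in Ω, |w x| ^ p ∂(gaussianMeasure n) := by
  have hfin := gauss_finite hΩo.measurableSet hΩb
  obtain ⟨C, hC⟩ := hw.bdd
  have hp0 : p ≠ 0 := by linarith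
  have hi : Integrable (fun x => |w x| ^ p) ((gaussianMeasure n).restrict Ω) := by
    refine Integrable.of_bound (((hw.c1.continuous.measurable.abs).pow_const
      p).aestronglyMeasurable) (C ^ p) ?_
    filter_upwards with x
    rw [Real.norm_of_nonneg (by positivity)]
    exact Real.rpow_le_rpow (abs_nonneg _) (hC x).1 (by linarith)
  rw [integral_pos_iff_support_of_nonneg (fun x => by simp only [Pi.zero_apply]; positivity) hi]
  have hs : Function.support (fun x => |w x| ^ p) = Function.support w := by
    ext x
    simp only [Function.mem_support, ne_eq, Real.rpow_eq_zero (abs_nonneg (w x)) hp0, abs_eq_zero]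
  rw [hs, pos_iff_ne_zero]
  intro hz
  obtain ⟨a, b, -, -, -, hab⟩ := gauss_compare Ω hΩo.measurableSet hΩb
  have h1 := hab (Function.support w)
  rw [Measure.smul_apply, hz, smul_zero,
    Measure.restrict_eq_self _ ((subset_tsupport w).trans hw.ts)] at h1
  have h2 : 0 < volume (Function.support w) :=
    (hw.c1.continuous.isOpen_support).measure_pos _ (Function.support_nonempty_iff.2 h0)
  exact absurd h1 (not_le.2 h2)

lemma exists_test (hp : 1 < p) (hΩo : IsOpen Ω) (hΩb : IsBounded Ω) (hne : Ω.Nonempty) (τ : ℝ)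
    (hτ : 0 < τ) : ∃ w, IsTestFun n Ω w ∧ ∫ x in Ω, |w x| ^ p ∂(gaussianMeasure n) = 1 ∧
      ∫ x in Ω, ‖gradient w x‖ ^ p ∂(gaussianMeasure n) < lambdaPGamma n p Ω + τ := by
  have hp0 : p ≠ 0 := by linarith
  obtain ⟨x, hx⟩ := hne
  obtain ⟨f, hf1, hf2, hf3, -, hf5⟩ := exists_contDiff_tsupport_subset (n := (⊤ : ℕ∞))
    (hΩo.mem_nhds hx)
  have hnes : { r : ℝ | ∃ v : EuclideanSpace ℝ (Fin n) → ℝ, IsTestFun n Ω v ∧ v ≠ 0 ∧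
    r = (∫ x in Ω, ‖gradient v x‖ ^ p ∂(gaussianMeasure n)) /
        (∫ x in Ω, |v x| ^ p ∂(gaussianMeasure n)) }.Nonempty :=
    ⟨_, f, ⟨hf3, hf2, hf1⟩, fun h => by rw [h] at hf5; simp at hf5, rfl⟩
  obtain ⟨_, ⟨v, hv, hv0, rfl⟩, hlt⟩ := exists_lt_of_csInf_lt hnes
    (show lambdaPGamma n p Ω < lambdaPGamma n p Ω + τ by linarith)
  have hD := pow_pos_int hp hΩo hΩb hv.c1c hv0
  set D := ∫ x in Ω, |v x| ^ p ∂(gaussianMeasure n)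
  set c := D ^ (-(1 / p))
  have hc : 0 < c := by positivity
  have hcp : c ^ p = D⁻¹ := by
    rw [← Real.rpow_mul hD.le, neg_mul, one_div_mul_cancel hp0, Real.rpow_neg_one]
  have hsub : Function.support (fun y => c * v y) ⊆ Function.support v := by
    intro y hy hvy
    apply hy
    simp [show v y = 0 from hvy]
  refine ⟨fun y => c * v y, ⟨contDiff_const.mul hv.1, hv.2.1.mul_left,
    (closure_mono hsub).trans hv.2.2⟩, ?_, ?_⟩
  · have : ∀ y, |c * v y| ^ p = D⁻¹ * |v y| ^ p := by
      intro y
      rw [abs_mul, abs_of_pos hc, Real.mul_rpow hc.le (abs_nonneg _), hcp]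
    simp_rw [this]
    rw [integral_const_mul]
    exact inv_mul_cancel₀ hD.ne'
  · have : ∀ y, ‖gradient (fun y => c * v y) y‖ ^ p = D⁻¹ * ‖gradient v y‖ ^ p := by
      intro y
      rw [gradient_const_mul' hv.c1c.c1, norm_smul, Real.norm_of_nonneg hc.le,
        Real.mul_rpow hc.le (norm_nonneg _), hcp]
    simp_rw [this]
    rw [integral_const_mul, inv_mul_eq_div]
    exact hlt

lemma J_meas (w : 𝔼 → ℝ) (ε : ℝ) {μ : Measure 𝔼} (hw : AEMeasurable w μ) :
    AEStronglyMeasurable (fun x => (ε * w x ^ 2 + ‖gradient w x‖ ^ 2) ^ (p / 2)) μ :=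
  ((((hw.pow_const 2).const_mul ε).add
    ((measurable_gradient w).norm.aemeasurable.pow_const 2)).pow_const _).aestronglyMeasurable

lemma C1c.J_bound (hp : 1 < p) {w : 𝔼 → ℝ} (hw : C1c Ω w) : ∃ C : ℝ, ∀ ε, 0 ≤ ε → ε ≤ 1 → ∀ x,
    ‖(ε * w x ^ 2 + ‖gradient w x‖ ^ 2) ^ (p / 2)‖ ≤ C := by
  obtain ⟨C, hC⟩ := hw.bdd
  refine ⟨(C ^ 2 + C ^ 2) ^ (p / 2), fun ε h0 h1 x => ?_⟩
  rw [Real.norm_of_nonneg (by positivity)]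
  have e1 := (hC x).1
  have e2 := (hC x).2
  refine Real.rpow_le_rpow (by positivity) ?_ (by linarith)
  have e3 : w x ^ 2 ≤ C ^ 2 := by
    rw [← sq_abs]; gcongr
  have e4 : ‖gradient w x‖ ^ 2 ≤ C ^ 2 := by gcongr
  nlinarith [sq_nonneg (w x)]

lemma sq_rpow_half {a p : ℝ} (ha : 0 ≤ a) : (a ^ 2) ^ (p / 2) = a ^ p := by
  rw [← Real.rpow_natCast, ← Real.rpow_mul ha]
  congr 1; push_cast; ring

lemma lamEps_le (hp : 1 < p) (hΩo : IsOpen Ω) (hΩb : IsBounded Ω) (hne : Ω.Nonempty) (τ : ℝ)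
    (hτ : 0 < τ) : ∀ᶠ ε in 𝓝[>] (0:ℝ), lambdaEps n p ε Ω ≤ lambdaPGamma n p Ω + τ := by
  have hfin := gauss_finite hΩo.measurableSet hΩb
  obtain ⟨w, hw, hw1, hw2⟩ := exists_test hp hΩo hΩb hne τ hτ
  obtain ⟨C, hC⟩ := hw.c1c.J_bound hp
  have ht : Filter.Tendsto (fun ε => Jeps n p ε Ω w) (𝓝[>] (0:ℝ))
      (𝓝 (∫ x in Ω, ‖gradient w x‖ ^ p ∂(gaussianMeasure n))) := by
    refine tendsto_integral_filter_of_dominated_convergence (fun _ => C)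
      (Filter.Eventually.of_forall fun ε => J_meas w ε hw.1.continuous.aemeasurable) ?_
      (integrable_const _) ?_
    · filter_upwards [Ioc_mem_nhdsGT (show (0:ℝ) < 1 by norm_num)] with ε hε
      filter_upwards with x using hC ε hε.1.le hε.2 x
    · filter_upwards with x
      have : Continuous fun ε : ℝ => (ε * w x ^ 2 + ‖gradient w x‖ ^ 2) ^ (p / 2) :=
        (by fun_prop : Continuous fun ε : ℝ => (ε * w x ^ 2 + ‖gradient w x‖ ^ 2)).rpow_const
          fun _ => Or.inr (by linarith)
      have h := (this.tendsto 0).mono_left (nhdsWithin_le_nhds (s := Ioi 0))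
      simp only [zero_mul, zero_add] at h
      rwa [sq_rpow_half (norm_nonneg _)] at h
  filter_upwards [ht.eventually (gt_mem_nhds hw2), self_mem_nhdsWithin] with ε hε hε0
  refine le_trans (csInf_le ⟨0, ?_⟩ ⟨w, hw, hw1, rfl⟩) hε.le
  rintro _ ⟨v, -, -, rfl⟩
  have : (0:ℝ) < ε := hε0
  exact integral_nonneg fun x => by positivity

lemma lamEps_pos (hp : 1 < p) (hΩo : IsOpen Ω) (hΩb : IsBounded Ω) (hne : Ω.Nonempty) (ε : ℝ)
    (hε : 0 < ε) (hε1 : ε ≤ 1) : 0 < lambdaEps n p ε Ω := by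
  have hfin := gauss_finite hΩo.measurableSet hΩb
  obtain ⟨w, hw, hw1, hw2⟩ := exists_test hp hΩo hΩb hne 1 one_pos
  refine lt_of_lt_of_le (show 0 < ε ^ (p / 2) by positivity) (le_csInf ⟨_, w, hw, hw1, rfl⟩ ?_)
  rintro _ ⟨v, hv, hv1, rfl⟩
  obtain ⟨C, hC⟩ := hv.c1c.J_bound hp
  have hi : Integrable (fun x => (ε * v x ^ 2 + ‖gradient v x‖ ^ 2) ^ (p / 2))
      ((gaussianMeasure n).restrict Ω) :=
    Integrable.of_bound (J_meas v ε hv.1.continuous.aemeasurable) C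
      (Filter.Eventually.of_forall fun x => hC ε hε.le hε1 x)
  calc ε ^ (p / 2) = ∫ x in Ω, ε ^ (p / 2) * |v x| ^ p ∂(gaussianMeasure n) := by
        rw [integral_const_mul, hv1, mul_one]
    _ ≤ _ := by
        refine integral_mono_of_nonneg (Filter.Eventually.of_forall fun x => by
          simp only [Pi.zero_apply]; positivity) hi (Filter.Eventually.of_forall fun x => ?_)
        simp only
        rw [← sq_rpow_half (abs_nonneg (v x)), ← Real.mul_rpow hε.le (by positivity), sq_abs]
        refine Real.rpow_le_rpow (by positivity) ?_ (by linarith)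
        nlinarith [sq_nonneg ‖gradient v x‖]

lemma min_grad (hp : 1 < p) (hΩo : IsOpen Ω) (hΩb : IsBounded Ω) (hne : Ω.Nonempty) (ε : ℝ)
    (hε : 0 < ε) (hε1 : ε ≤ 1) {w : 𝔼 → ℝ} (hw : IsNormalizedMinimizer n p ε Ω w) :
    Integrable (fun x => ‖gradient w x‖ ^ p) ((gaussianMeasure n).restrict Ω) ∧
    ∫ x in Ω, ‖gradient w x‖ ^ p ∂(gaussianMeasure n) ≤ lambdaEps n p ε Ω := by
  have hpos := lamEps_pos hp hΩo hΩb hne ε hε hε1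
  obtain ⟨-, -, -, -, -, hJ⟩ := hw
  have hi : Integrable (fun x => (ε * w x ^ 2 + ‖gradient w x‖ ^ 2) ^ (p / 2))
      ((gaussianMeasure n).restrict Ω) := by
    by_contra h
    rw [Jeps, integral_undef h] at hJ
    exact hpos.ne hJ
  have hle : ∀ x, ‖gradient w x‖ ^ p ≤ (ε * w x ^ 2 + ‖gradient w x‖ ^ 2) ^ (p / 2) := by
    intro x
    rw [← sq_rpow_half (norm_nonneg (gradient w x))]
    refine Real.rpow_le_rpow (by positivity) ?_ (by linarith)
    nlinarith [sq_nonneg (w x)]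
  have hg : Integrable (fun x => ‖gradient w x‖ ^ p) ((gaussianMeasure n).restrict Ω) := by
    refine hi.mono' ((measurable_gradient w).norm.pow_const p).aestronglyMeasurable
      (Filter.Eventually.of_forall fun x => ?_)
    rw [Real.norm_of_nonneg (by positivity)]
    exact hle x
  exact ⟨hg, hJ ▸ integral_mono hg hi hle⟩
end Fin8

section Fin9
variable {n : ℕ}
local notation "𝔼" => EuclideanSpace ℝ (Fin n)
variable {p M : ℝ} {Ω : Set (EuclideanSpace ℝ (Fin n))} {u : EuclideanSpace ℝ (Fin n) → ℝ}

lemma approx_min (hp : 1 < p) (hΩo : IsOpen Ω) (hΩb : IsBounded Ω) {ε : ℝ} {w : 𝔼 → ℝ}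
    (hw : IsNormalizedMinimizer n p ε Ω w)
    (hg : Integrable (fun x => ‖gradient w x‖ ^ p) ((gaussianMeasure n).restrict Ω))
    (δ : ℝ) (hδ : 0 < δ) :
    ∃ v, C1c Ω v ∧ (∀ x, 0 ≤ v x) ∧ |∫ x in Ω, v x ^ p ∂(gaussianMeasure n) - 1| ≤ δ ∧
      ∫ x in Ω, ‖gradient v x‖ ^ p ∂(gaussianMeasure n) ≤
        ∫ x in Ω, ‖gradient w x‖ ^ p ∂(gaussianMeasure n) + δ ∧
      ∫⁻ x in Ω, ‖w x - v x‖ₑ ^ p ∂(gaussianMeasure n) ≤ ENNReal.ofReal δ ∧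
      ∫⁻ x in Ω, ‖gradient w x - gradient v x‖ₑ ^ p ∂(gaussianMeasure n) ≤ ENNReal.ofReal δ := by
  have hp0 : 0 < p := by linarith
  obtain ⟨hwc, hw1, hw0, hwb, hwn, -⟩ := hw
  obtain ⟨v, C, hv⟩ := trunc Ω hΩo hΩb w hwc hw1 hw0 hwb
  have hmem := ae_restrict_mem (μ := gaussianMeasure n) hΩo.measurableSet
  have hw0' : ∀ x ∈ Ω, 0 ≤ w x := fun x hx => hw0 x (subset_closure hx)
  have hwm : AEMeasurable w ((gaussianMeasure n).restrict Ω) :=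
    hw1.continuousOn.aemeasurable hΩo.measurableSet
  have hvm : ∀ k, Measurable (v k) := fun k => (hv k).1.1.continuous.measurable
  set μ := (gaussianMeasure n).restrict Ω
  have hwi : Integrable (fun x => w x ^ p) μ := by
    by_contra h
    rw [integral_undef h] at hwn
    exact zero_ne_one hwn
  have hwi' : Integrable (fun x => ‖w x‖ ^ p) μ := by
    refine (integrable_congr ?_).2 hwi
    filter_upwards [hmem] with x hx
    rw [Real.norm_of_nonneg (hw0' x hx)]
  have t1 : Filter.Tendsto (fun k => ∫ x, v k x ^ p ∂μ) Filter.atTop (𝓝 1) := by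
    rw [← hwn]
    refine tendsto_integral_of_dominated_convergence (fun x => w x ^ p)
      (fun k => ((hvm k).pow_const p).aestronglyMeasurable) hwi (fun k => ?_) ?_
    · filter_upwards [hmem] with x hx
      have h1 := (hv k).1.2.2.2.1 x
      rw [Real.norm_of_nonneg (by positivity)]
      exact Real.rpow_le_rpow h1 ((hv k).1.2.2.2.2 x hx).1 hp0.le
    · filter_upwards [hmem] with x hx
      refine tendsto_const_nhds.congr' ?_
      filter_upwards [(hv 0).2 x hx] with k hk
      rw [hk.1]
  have hgb : ∀ k, ∀ x ∈ Ω, ‖gradient (v k) x‖ ≤ |C| * ‖gradient w x‖ := fun k x hx =>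
    ((hv k).1.2.2.2.2 x hx).2.trans
      (mul_le_mul_of_nonneg_right (le_abs_self C) (norm_nonneg _))
  have t2 : Filter.Tendsto (fun k => ∫ x, ‖gradient (v k) x‖ ^ p ∂μ) Filter.atTop
      (𝓝 (∫ x, ‖gradient w x‖ ^ p ∂μ)) := by
    refine tendsto_integral_of_dominated_convergence (fun x => |C| ^ p * ‖gradient w x‖ ^ p)
      (fun k => ((measurable_gradient _).norm.pow_const p).aestronglyMeasurable)
      (hg.const_mul _) (fun k => ?_) ?_
    · filter_upwards [hmem] with x hx
      rw [Real.norm_of_nonneg (by positivity), ← Real.mul_rpow (abs_nonneg _) (norm_nonneg _)]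
      exact Real.rpow_le_rpow (norm_nonneg _) (hgb k x hx) hp0.le
    · filter_upwards [hmem] with x hx
      refine tendsto_const_nhds.congr' ?_
      filter_upwards [(hv 0).2 x hx] with k hk
      rw [hk.2]
  have t3 : Filter.Tendsto (fun k => ∫⁻ x, ‖w x - v k x‖ₑ ^ p ∂μ) Filter.atTop (𝓝 0) := by
    rw [← lintegral_zero (μ := μ)]
    refine tendsto_lintegral_of_dominated_convergence' (fun x => ‖w x‖ₑ ^ p)
      (fun k => ((hwm.sub (hvm k).aemeasurable).enorm).pow_const p) (fun k => ?_) ?_ ?_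
    · filter_upwards [hmem] with x hx
      refine ENNReal.rpow_le_rpow ?_ hp0.le
      have h1 := (hv k).1.2.2.2.1 x
      have h2 := ((hv k).1.2.2.2.2 x hx).1
      rw [Real.enorm_eq_ofReal (by linarith), Real.enorm_eq_ofReal (by linarith)]
      exact ENNReal.ofReal_le_ofReal (by linarith)
    · rw [int_lint hp hwi']; exact ENNReal.ofReal_ne_top
    · filter_upwards [hmem] with x hx
      refine tendsto_const_nhds.congr' ?_
      filter_upwards [(hv 0).2 x hx] with k hk
      rw [hk.1]; simp [hp0]
  have t4 : Filter.Tendsto (fun k => ∫⁻ x, ‖gradient w x - gradient (v k) x‖ₑ ^ p ∂μ)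
      Filter.atTop (𝓝 0) := by
    rw [← lintegral_zero (μ := μ)]
    have hgi : Integrable (fun x => ‖(1 + |C|) • gradient w x‖ ^ p) μ := by
      have : (fun x => ‖(1 + |C|) • gradient w x‖ ^ p) =
          fun x => (1 + |C|) ^ p * ‖gradient w x‖ ^ p := by
        ext x
        rw [norm_smul, Real.norm_of_nonneg (by positivity),
          Real.mul_rpow (by positivity) (norm_nonneg _)]
      rw [this]
      exact hg.const_mul _
    refine tendsto_lintegral_of_dominated_convergence' (fun x => ‖(1 + |C|) • gradient w x‖ₑ ^ p)
      (fun k => (((measurable_gradient w).sub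
        (measurable_gradient (v k))).enorm.pow_const p).aemeasurable) (fun k => ?_) ?_ ?_
    · filter_upwards [hmem] with x hx
      refine ENNReal.rpow_le_rpow ?_ hp0.le
      rw [← ofReal_norm_eq_enorm, ← ofReal_norm_eq_enorm]
      refine ENNReal.ofReal_le_ofReal ?_
      rw [norm_smul, Real.norm_of_nonneg (by positivity)]
      linarith [norm_sub_le (gradient w x) (gradient (v k) x), hgb k x hx]
    · rw [int_lint hp hgi]; exact ENNReal.ofReal_ne_top
    · filter_upwards [hmem] with x hx
      refine tendsto_const_nhds.congr' ?_
      filter_upwards [(hv 0).2 x hx] with k hk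
      rw [hk.2]; simp [hp0]
  have hδ' : (0:ENNReal) < ENNReal.ofReal δ := ENNReal.ofReal_pos.2 hδ
  obtain ⟨k, h1, h2, h3, h4⟩ := ((Metric.tendsto_nhds.1 t1 δ hδ).and
    ((t2.eventually (gt_mem_nhds (lt_add_of_pos_right _ hδ))).and
    ((t3.eventually (gt_mem_nhds hδ')).and (t4.eventually (gt_mem_nhds hδ'))))).exists
  exact ⟨v k, ⟨(hv k).1.1, (hv k).1.2.1, (hv k).1.2.2.1⟩, (hv k).1.2.2.2.1, h1.le, h2.le, h3.le,
    h4.le⟩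

lemma tri_tendsto {F : Type*} [NormedAddCommGroup F] (hp : 1 < p) {μ : Measure 𝔼}
    {f g : ℕ → 𝔼 → F} {h : 𝔼 → F}
    (hm : ∀ k, AEStronglyMeasurable (fun x => f k x - g k x) μ)
    (h1 : Filter.Tendsto (fun k => ∫⁻ x, ‖f k x - g k x‖ₑ ^ p ∂μ) Filter.atTop (𝓝 0))
    (h2 : Filter.Tendsto (fun k => ∫⁻ x, ‖g k x - h x‖ₑ ^ p ∂μ) Filter.atTop (𝓝 0)) :
    Filter.Tendsto (fun k => ∫⁻ x, ‖f k x - h x‖ₑ ^ p ∂μ) Filter.atTop (𝓝 0) := by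
  have hD : (2:ENNReal) ^ (p - 1) ≠ ⊤ :=
    ENNReal.rpow_ne_top_of_nonneg (by linarith) (by simp)
  have h3 := ENNReal.Tendsto.const_mul (a := (2:ENNReal) ^ (p - 1)) (h1.add h2) (Or.inr hD)
  rw [add_zero, mul_zero] at h3
  refine tendsto_of_tendsto_of_tendsto_of_le_of_le tendsto_const_nhds h3 (fun _ => zero_le) ?_
  intro k
  calc ∫⁻ x, ‖f k x - h x‖ₑ ^ p ∂μ
      ≤ ∫⁻ x, (2:ENNReal) ^ (p - 1) * (‖f k x - g k x‖ₑ ^ p + ‖g k x - h x‖ₑ ^ p) ∂μ := by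
        refine lintegral_mono fun x => ?_
        refine le_trans ?_ (ENNReal.rpow_add_le_mul_rpow_add_rpow _ _ hp.le)
        refine ENNReal.rpow_le_rpow ?_ (by linarith)
        rw [← sub_add_sub_cancel (f k x) (g k x) (h x)]
        exact enorm_add_le _ _
    _ = _ := by
        rw [lintegral_const_mul' _ _ hD, lintegral_add_left' ((hm k).enorm.pow_const p)]

lemma main_aux (H : Eig n p Ω u M) (η : ℝ) (hη : 0 < η) : ∃ ε₀ : ℝ, 0 < ε₀ ∧
      ∀ ε : ℝ, 0 < ε → ε < ε₀ →
        ∀ uε : EuclideanSpace ℝ (Fin n) → ℝ, IsNormalizedMinimizer n p ε Ω uε →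
          (∫ x in Ω, (‖gradient uε x - gradient u x‖ ^ p + |uε x - u x| ^ p)
            ∂(gaussianMeasure n)) < η := by
  have hp := H.hp
  have hp0 : 0 < p := by linarith
  by_contra! hcon
  have hk0 : ∀ k : ℕ, (0:ℝ) < 1 / ((k:ℝ) + 1) := fun k => by positivity
  choose ε hε0 hεk w hw hwη using fun k : ℕ => hcon (1 / ((k:ℝ) + 1)) (hk0 k)
  have hlim := tendsto_one_div_add_atTop_nhds_zero_nat (𝕜 := ℝ)
  have hε1 : ∀ k, ε k ≤ 1 := fun k => (hεk k).le.trans (by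
    rw [div_le_one (by positivity)]; have : (0:ℝ) ≤ k := by positivity
    linarith)
  have hεlim : Filter.Tendsto ε Filter.atTop (𝓝[>] 0) :=
    tendsto_nhdsWithin_iff.2 ⟨squeeze_zero (fun k => (hε0 k).le) (fun k => (hεk k).le) hlim,
      Filter.Eventually.of_forall hε0⟩
  have hwg := fun k => min_grad hp H.ho H.hb H.hne (ε k) (hε0 k) (hε1 k) (hw k)
  choose v hv hv0 hvn hvg hd1 hd2 using fun k =>
    approx_min hp H.ho H.hb (hw k) (hwg k).1 (1 / ((k:ℝ) + 1)) (hk0 k)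
  have hn1 : Filter.Tendsto (fun k => ∫ x in Ω, v k x ^ p ∂(gaussianMeasure n)) Filter.atTop
      (𝓝 1) := by
    rw [tendsto_iff_dist_tendsto_zero]
    exact squeeze_zero (fun k => dist_nonneg) hvn hlim
  have A : Apx n p Ω v (fun k => ∫ x in Ω, ‖gradient (v k) x‖ ^ p ∂(gaussianMeasure n)) := by
    refine ⟨hv, hv0, hn1, fun k => le_rfl, ?_⟩
    rw [tendsto_order]
    constructor
    · intro a ha
      have h1 := hn1.const_mul (lambdaPGamma n p Ω)
      rw [mul_one] at h1
      filter_upwards [h1.eventually (lt_mem_nhds ha)] with k hk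
      have h2 := (H.picone (hv k) (hv0 k)).2
      have h3 : 0 ≤ ∫ x in Ω, breg p (gradient (v k) x) ((v k x / u x) • gradient u x)
        ∂(gaussianMeasure n) := integral_nonneg fun x => breg_nonneg hp _ _
      linarith
    · intro a ha
      have h1 := hεlim.eventually (lamEps_le hp H.ho H.hb H.hne ((a - lambdaPGamma n p Ω) / 2)
        (by linarith))
      filter_upwards [h1, hlim.eventually (gt_mem_nhds
        (show 0 < (a - lambdaPGamma n p Ω) / 2 by linarith))] with k h2 h3
      linarith [hvg k, (hwg k).2]
  have hlim' : Filter.Tendsto (fun k : ℕ => ENNReal.ofReal (1 / ((k:ℝ) + 1))) Filter.atTop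
      (𝓝 0) := by
    simpa using ENNReal.tendsto_ofReal hlim
  have hz : ∀ f : ℕ → ENNReal, (∀ k, f k ≤ ENNReal.ofReal (1 / ((k:ℝ) + 1))) →
      Filter.Tendsto f Filter.atTop (𝓝 0) := fun f hf =>
    tendsto_of_tendsto_of_tendsto_of_le_of_le tendsto_const_nhds hlim' (fun _ => zero_le) hf
  have hwm : ∀ k, AEMeasurable (w k) ((gaussianMeasure n).restrict Ω) := fun k =>
    (hw k).2.1.continuousOn.aemeasurable H.ho.measurableSet
  have hvm : ∀ k, AEMeasurable (v k) ((gaussianMeasure n).restrict Ω) := fun k =>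
    (hv k).c1.continuous.aemeasurable
  have hG := tri_tendsto hp (f := fun k => gradient (w k)) (g := fun k => gradient (v k))
    (h := gradient u)
    (fun k => ((measurable_gradient (w k)).sub (measurable_gradient (v k))).aestronglyMeasurable)
    (hz _ hd2) (A.stepD H)
  have hC : Filter.Tendsto (fun k => ∫⁻ x in Ω, ‖v k x - u x‖ₑ ^ p ∂(gaussianMeasure n))
      Filter.atTop (𝓝 0) := by
    have h1 := (A.stepC H).ennrpow_const p
    rw [ENNReal.zero_rpow_of_pos hp0] at h1
    refine h1.congr fun k => ?_
    rw [eLpNorm', ← ENNReal.rpow_mul, one_div_mul_cancel hp0.ne', ENNReal.rpow_one]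
    rfl
  have hU := tri_tendsto hp (f := w) (g := v) (h := u)
    (fun k => ((hwm k).sub (hvm k)).aestronglyMeasurable) (hz _ hd1) hC
  have hS := hG.add hU
  rw [add_zero] at hS
  obtain ⟨k, hk⟩ := (hS.eventually (gt_mem_nhds (ENNReal.ofReal_pos.2 hη))).exists
  refine absurd (hwη k) (not_le.2 ?_)
  by_cases hi : Integrable (fun x => ‖gradient (w k) x - gradient u x‖ ^ p + |w k x - u x| ^ p)
      ((gaussianMeasure n).restrict Ω)
  · rw [← ENNReal.ofReal_lt_ofReal_iff hη, ofReal_integral_eq_lintegral_ofReal hi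
      (Filter.Eventually.of_forall fun x => by simp only [Pi.zero_apply]; positivity)]
    refine lt_of_eq_of_lt ?_ hk
    have hm : Measurable (fun x => ‖gradient (w k) x - gradient u x‖ₑ ^ p) :=
      ((measurable_gradient (w k)).sub (measurable_gradient u)).enorm.pow_const p
    rw [← lintegral_add_left hm]
    refine lintegral_congr fun x => ?_
    rw [ENNReal.ofReal_add (by positivity) (by positivity), enorm_rpow_ofReal _ hp0.le,
      enorm_rpow_ofReal _ hp0.le, Real.norm_eq_abs]
  · rw [integral_undef hi]; exact hη
end Fin9

/-- **Convergence of the regularized minimizers in `W^{1,p}(γ)`** (Proposition 4.3 of the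
paper): as `ε → 0⁺`, the normalized minimizers of the `ε`-regularized problems converge in
the Gaussian Sobolev norm to the unique normalized positive first eigenfunction `u`. -/
theorem regularized_minimizers_converge_W1p
    (n : ℕ) (hn : 2 ≤ n) (p : ℝ) (hp : 1 < p)
    (Ω : Set (EuclideanSpace ℝ (Fin n)))
    (hΩo : IsOpen Ω) (hΩb : IsBounded Ω) (hΩconv : Convex ℝ Ω) (hΩ2 : HasC2Boundary n Ω)
    (hsc : ∃ R : ℝ, 0 < R ∧ ∀ x ∈ frontier Ω, ∃ y : EuclideanSpace ℝ (Fin n),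
      dist x y = R ∧ closure Ω ⊆ Metric.closedBall y R)
    (u : EuclideanSpace ℝ (Fin n) → ℝ)
    (hu1 : ContDiffOn ℝ 1 u (closure Ω))
    (hupos : ∀ x ∈ Ω, 0 < u x)
    (hub : ∀ x ∈ frontier Ω, u x = 0)
    (hnorm : (∫ x in Ω, u x ^ p ∂(gaussianMeasure n)) = 1)
    (heig : ∀ φ : EuclideanSpace ℝ (Fin n) → ℝ, IsTestFun n Ω φ →
      ∫ x in Ω, ‖gradient u x‖ ^ (p - 2) * ⟪gradient u x, gradient φ x⟫ ∂(gaussianMeasure n)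
        = lambdaPGamma n p Ω * ∫ x in Ω, u x ^ (p - 1) * φ x ∂(gaussianMeasure n)) :
    ∀ η : ℝ, 0 < η → ∃ ε₀ : ℝ, 0 < ε₀ ∧
      ∀ ε : ℝ, 0 < ε → ε < ε₀ →
        ∀ uε : EuclideanSpace ℝ (Fin n) → ℝ, IsNormalizedMinimizer n p ε Ω uε →
          (∫ x in Ω, (‖gradient uε x - gradient u x‖ ^ p + |uε x - u x| ^ p)
            ∂(gaussianMeasure n)) < η := by
  obtain ⟨M, H⟩ := mk_eig hp hΩo hΩb hΩconv hu1 hupos hub hnorm heig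
  exact fun η hη => main_aux H η hη
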